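/- arXiv:1604.05412 — 13 statements merged into one kernel-verified Lean document; each statement's English description precedes it below -/
import Mathlib

section
/- Let Δ be a strongly shellable simplicial complex. Then for each pair of facets F₁ and F₂ of Δ with dim(F₁) < dim(F₂), there exists a facet G of Δ such that dim(F₁) = dim(F₁ ∩ G) + 1 (equivalently |F₁ ∖ G| = 1) and F₁ ∩ F₂ ⊆ G ⊆ F₁ ∪ F₂. -/
variable {α : Type*}

/-- A (nonempty) simplicial complex: a finite nonempty collection of finite sets
closed under taking subsets. -/
def IsComplex (Δ : Finset (Finset α)) : Prop :=
  Δ.Nonempty ∧ ∀ F ∈ Δ, ∀ G ⊆ F, G ∈ Δ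

/-- A facet: a face maximal under inclusion. -/
def IsFacet (Δ : Finset (Finset α)) (F : Finset α) : Prop :=
  F ∈ Δ ∧ ∀ G ∈ Δ, F ⊆ G → F = G

/-- `L` is a strong shelling order on the facet set of `Δ`: `L` enumerates the
facets without repetition, and for all `i < j` there is `k < j` with
`|F_j \ F_k| = 1`, `F_j \ F_k ⊆ F_j \ F_i` and `F_k \ F_j ⊆ F_i`. -/
def IsSSO [DecidableEq α] (Δ : Finset (Finset α)) (L : List (Finset α)) : Prop :=
  L.Nodup ∧ (∀ F, F ∈ L ↔ IsFacet Δ F) ∧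
    ∀ i j : Fin L.length, i < j → ∃ k : Fin L.length, k < j ∧
      (L.get j \ L.get k).card = 1 ∧
      L.get j \ L.get k ⊆ L.get j \ L.get i ∧
      L.get k \ L.get j ⊆ L.get i

/-- A complex is strongly shellable if its facet set admits a strong shelling order. -/
def StronglyShellable [DecidableEq α] (Δ : Finset (Finset α)) : Prop :=
  ∃ L, IsSSO Δ L

/-- A facet `G` missing exactly one vertex of a facet `F` is at least as large as `F`, since it
must contain a vertex outside `F`. -/
theorem IsFacet.card_le_of_card_sdiff_eq_one [DecidableEq α] {Δ : Finset (Finset α)}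
    {F G : Finset α} (hF : IsFacet Δ F) (hG : IsFacet Δ G) (h : (F \ G).card = 1) :
    F.card ≤ G.card := by
  have hne : (G \ F).Nonempty := by
    rw [Finset.sdiff_nonempty]
    intro hsub
    have hGF := hG.2 F hF.1 hsub
    simp [hGF] at h
  have hpos := hne.card_pos
  have hFG := Finset.card_sdiff_add_card F G
  have hGF := Finset.card_sdiff_add_card G F
  rw [Finset.union_comm] at hGF
  omega

/-- The exchange property for facets `L.get i` and `L.get j` of a strong shelling order. -/
theorem IsSSO.exists_exchange [DecidableEq α] {Δ : Finset (Finset α)} {L : List (Finset α)}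
    (hL : IsSSO Δ L) (i j : Fin L.length) (hcard : (L.get i).card < (L.get j).card) :
    ∃ G, IsFacet Δ G ∧ (L.get i \ G).card = 1 ∧ L.get i ∩ L.get j ⊆ G ∧
      G ⊆ L.get i ∪ L.get j := by
  have hfacet : ∀ k, IsFacet Δ (L.get k) := fun k => (hL.2.1 _).1 (L.get_mem k)
  induction j using WellFoundedLT.induction with
  | ind j ih =>
    rcases lt_trichotomy i j with hij | rfl | hji
    · obtain ⟨k, hkj, hone, hsub, hsup⟩ := hL.2.2 i j hij
      have hle := (hfacet j).card_le_of_card_sdiff_eq_one (hfacet k) hone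
      obtain ⟨G, hG, hG1, hGinf, hGsup⟩ := ih k hkj (hcard.trans_le hle)
      refine ⟨G, hG, hG1, fun x hx => ?_, fun x hx => ?_⟩
      · have := @hsub x
        have := @hGinf x
        simp only [Finset.mem_inter, Finset.mem_sdiff] at *
        tauto
      · have := @hsup x
        have := hGsup hx
        simp only [Finset.mem_union, Finset.mem_sdiff] at *
        tauto
    · exact absurd hcard (lt_irrefl _)
    · obtain ⟨k, -, hone, hsub, hsup⟩ := hL.2.2 j i hji
      refine ⟨L.get k, hfacet k, hone, fun x hx => ?_, fun x hx => ?_⟩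
      · have := @hsub x
        simp only [Finset.mem_inter, Finset.mem_sdiff] at *
        tauto
      · have := @hsup x
        simp only [Finset.mem_union, Finset.mem_sdiff] at *
        tauto

/-- If `Δ` is strongly shellable and `F₁`, `F₂` are facets with
`dim F₁ < dim F₂` (i.e. `|F₁| < |F₂|`), then there is a facet `G` with
`|F₁ \ G| = 1` and `F₁ ∩ F₂ ⊆ G ⊆ F₁ ∪ F₂`. -/
theorem stmt0 [DecidableEq α] (Δ : Finset (Finset α)) (hΔ : IsComplex Δ)
    (hss : StronglyShellable Δ) (F₁ F₂ : Finset α)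
    (h₁ : IsFacet Δ F₁) (h₂ : IsFacet Δ F₂) (hdim : F₁.card < F₂.card) :
    ∃ G, IsFacet Δ G ∧ (F₁ \ G).card = 1 ∧ F₁ ∩ F₂ ⊆ G ∧ G ⊆ F₁ ∪ F₂ := by
  obtain ⟨L, hL⟩ := hss
  obtain ⟨i, rfl⟩ := List.get_of_mem ((hL.2.1 F₁).2 h₁)
  obtain ⟨j, rfl⟩ := List.get_of_mem ((hL.2.1 F₂).2 h₂)
  exact hL.exists_exchange i j hdim
end

section
/- Let Δ be a strongly shellable simplicial complex of positive dimension. Then the pure complex generated by the 1-dimensional facets of Δ (i.e. the complex whose facets are exactly the facets of Δ of dimension 1) is also strongly shellable. -/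
variable {α : Type*}

/-- The simplicial complex generated by a collection of sets: all their subsets. -/
def gen [DecidableEq α] (S : Finset (Finset α)) : Finset (Finset α) :=
  S.biUnion Finset.powerset

/-- The facets of a complex generated by sets of a common cardinality are its generators. -/
theorem isFacet_gen_iff [DecidableEq α] {S : Finset (Finset α)} {n : ℕ}
    (hS : ∀ F ∈ S, F.card = n) (F : Finset α) : IsFacet (gen S) F ↔ F ∈ S := by
  simp only [IsFacet, gen, Finset.mem_biUnion, Finset.mem_powerset]
  constructor
  · rintro ⟨⟨G, hG, hFG⟩, hmax⟩
    rwa [hmax G ⟨G, hG, subset_rfl⟩ hFG]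
  · refine fun hF => ⟨⟨F, hF, subset_rfl⟩, ?_⟩
    rintro G ⟨H, hH, hGH⟩ hFG
    refine Finset.eq_of_subset_of_card_le hFG ?_
    rw [hS F hF, ← hS H hH]
    exact Finset.card_le_card hGH

/-- A facet that meets the edge `B` in one vertex and whose other vertices lie in an edge facet
`A` disjoint from `B` is itself an edge. -/
theorem IsFacet.card_eq_two_of_sdiff_subset [DecidableEq α] {Δ : Finset (Finset α)}
    {A B C : Finset α} (hA : IsFacet Δ A) (hB : IsFacet Δ B) (hC : IsFacet Δ C)
    (hAcard : A.card = 2) (hBcard : B.card = 2) (hAB : Disjoint B A)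
    (hBC : (B \ C).card = 1) (hCB : C \ B ⊆ A) : C.card = 2 := by
  have hle : (C \ B).card ≤ 2 := hAcard ▸ Finset.card_le_card hCB
  have hB_split := Finset.card_sdiff_add_card_inter B C
  have hC_split := Finset.card_sdiff_add_card_inter C B
  rw [Finset.inter_comm C B] at hC_split
  have hne_zero : (C \ B).card ≠ 0 := by
    intro h
    have hsub : C ⊆ B := by simpa [Finset.sdiff_eq_empty_iff_subset] using h
    simp [hC.2 B hB.1 hsub] at hBC
  have hne_two : (C \ B).card ≠ 2 := by
    intro h
    have heq : C \ B = A := Finset.eq_of_subset_of_card_le hCB (by omega)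
    have hAC : A = C := hA.2 C hC.1 (heq ▸ Finset.sdiff_subset)
    rw [← hAC, Finset.sdiff_eq_self_of_disjoint hAB] at hBC
    omega
  omega

/-- if `Δ` is strongly shellable of positive dimension (here: it has a
facet of dimension 1, i.e. of cardinality 2), then the pure complex generated by the
1-dimensional facets of `Δ` is strongly shellable. -/
theorem stmt3 [DecidableEq α] (Δ : Finset (Finset α)) (hΔ : IsComplex Δ)
    (hss : StronglyShellable Δ)
    (hdim : ∃ F, IsFacet Δ F ∧ F.card = 2) :
    StronglyShellable
      (gen (Δ.filter (fun F => (∀ G ∈ Δ, F ⊆ G → F = G) ∧ F.card = 2))) := by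
  obtain ⟨L, hnodup, hmem, hshell⟩ := hss
  set M := L.filter (fun F => F.card = 2) with hM
  have hmemM : ∀ F, F ∈ M ↔ IsFacet Δ F ∧ F.card = 2 := by
    intro F
    simp [hM, hmem]
  refine ⟨M, hnodup.filter _, fun F => ?_, fun i j hij => ?_⟩
  · rw [isFacet_gen_iff (n := 2) (by simp +contextual), hmemM, Finset.mem_filter, IsFacet,
      and_assoc]
  obtain ⟨f, hf⟩ := List.sublist_iff_exists_fin_orderEmbedding_get_eq.1
    (List.filter_sublist : M.Sublist L)
  obtain ⟨hA, hAcard⟩ := (hmemM _).1 (M.get_mem i)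
  obtain ⟨hB, hBcard⟩ := (hmemM _).1 (M.get_mem j)
  by_cases hdisj : Disjoint (M.get j) (M.get i)
  · obtain ⟨k, hkj, hcard, hsub, hsub'⟩ := hshell (f i) (f j) (f.lt_iff_lt.2 hij)
    rw [← hf, ← hf] at hsub
    rw [← hf] at hcard
    rw [← hf, ← hf] at hsub'
    have hC : IsFacet Δ (L.get k) := (hmem _).1 (L.get_mem k)
    obtain ⟨m, hm⟩ := List.mem_iff_get.1 ((hmemM _).2
      ⟨hC, hA.card_eq_two_of_sdiff_subset hB hC hAcard hBcard hdisj hcard hsub'⟩)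
    have hmk : f m = k := hnodup.injective_get ((hf m).symm.trans hm)
    refine ⟨m, f.lt_iff_lt.1 (hmk ▸ hkj), ?_⟩
    rw [hm]
    exact ⟨hcard, hsub, hsub'⟩
  · refine ⟨i, hij, ?_, subset_rfl, Finset.sdiff_subset⟩
    have hsplit := Finset.card_sdiff_add_card_inter (M.get j) (M.get i)
    have hinter : 0 < (M.get j ∩ M.get i).card :=
      Finset.card_pos.2 (Finset.not_disjoint_iff_nonempty_inter.1 hdisj)
    have hne_zero : (M.get j \ M.get i).card ≠ 0 := by
      intro h
      have hsub : M.get j ⊆ M.get i := by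
        rwa [Finset.card_eq_zero, Finset.sdiff_eq_empty_iff_subset] at h
      exact hij.ne' ((hnodup.filter _).injective_get (hB.2 _ hA.1 hsub))
    omega
end

section
/- Let Δ be a strongly shellable simplicial complex. Then for every face A ∈ Δ, the link link_Δ(A) is also strongly shellable. -/
variable {α : Type*}

/-- The link of a face `A` in `Δ`: `{B ∈ Δ : B ∪ A ∈ Δ, B ∩ A = ∅}`. -/
def link [DecidableEq α] (Δ : Finset (Finset α)) (A : Finset α) : Finset (Finset α) :=
  Δ.filter (fun B => B ∪ A ∈ Δ ∧ B ∩ A = ∅)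

/-- An index condition "every `i < j` has some `k < j` with `R F_j F_i F_k`" on a list, expressed
through the decompositions of the list at one of its entries. -/
theorem List.forall_lt_exists_lt_get_iff {β : Type*} (R : β → β → β → Prop) (L : List β) :
    (∀ i j : Fin L.length, i < j → ∃ k : Fin L.length, k < j ∧ R (L.get j) (L.get i) (L.get k)) ↔
      ∀ P F S, L = P ++ F :: S → ∀ G ∈ P, ∃ H ∈ P, R F G H := by
  constructor
  · rintro h P F S rfl G hG
    obtain ⟨i, hi, rfl⟩ := List.getElem_of_mem hG
    obtain ⟨⟨k, hk⟩, hkj, hR⟩ := h ⟨i, by simp; omega⟩ ⟨P.length, by simp⟩ hi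
    have hkP : k < P.length := hkj
    refine ⟨P[k], List.getElem_mem _, ?_⟩
    simpa [List.getElem_append_left hi, List.getElem_append_left hkP] using hR
  · rintro h ⟨i, hi⟩ ⟨j, hj⟩ hij
    have hij' : i < j := hij
    have hL : L = L.take j ++ L[j] :: L.drop (j + 1) := by simp
    obtain ⟨H, hH, hR⟩ := h _ _ _ hL L[i] (List.mem_take_iff_getElem.2 ⟨i, by omega, rfl⟩)
    obtain ⟨k, hk, rfl⟩ := List.mem_take_iff_getElem.1 hH
    exact ⟨⟨k, by omega⟩, Fin.mk_lt_mk.2 (by omega), hR⟩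

/-- The facets of the link of `A` are the sets `F \ A` for facets `F` containing `A`. -/
theorem isFacet_link_iff [DecidableEq α] {Δ : Finset (Finset α)} (hΔ : IsComplex Δ)
    {A B : Finset α} :
    IsFacet (link Δ A) B ↔ ∃ F, IsFacet Δ F ∧ A ⊆ F ∧ F \ A = B := by
  have mem_link : ∀ G ∈ Δ, A ⊆ G → G \ A ∈ link Δ A := fun G hG hAG =>
    Finset.mem_filter.2 ⟨hΔ.2 G hG _ Finset.sdiff_subset,
      by rwa [Finset.sdiff_union_of_subset hAG], Finset.sdiff_inter_self A G⟩
  constructor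
  · rintro ⟨hB, hmax⟩
    obtain ⟨-, hBA, hdisj⟩ := Finset.mem_filter.1 hB
    refine ⟨B ∪ A, ⟨hBA, fun G hG hsub => ?_⟩, Finset.subset_union_right, ?_⟩
    · have hAG : A ⊆ G := Finset.subset_union_right.trans hsub
      have hBG : B ⊆ G \ A := Finset.subset_sdiff.2
        ⟨Finset.subset_union_left.trans hsub, Finset.disjoint_iff_inter_eq_empty.2 hdisj⟩
      rw [hmax (G \ A) (mem_link G hG hAG) hBG, Finset.sdiff_union_of_subset hAG]
    · exact Finset.union_sdiff_cancel_right (Finset.disjoint_iff_inter_eq_empty.2 hdisj)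
  · rintro ⟨F, ⟨hF, hmax⟩, hAF, rfl⟩
    refine ⟨mem_link F hF hAF, fun G hG hsub => ?_⟩
    obtain ⟨-, hGA, hdisj⟩ := Finset.mem_filter.1 hG
    rw [hmax (G ∪ A) hGA (by grind),
      Finset.union_sdiff_cancel_right (Finset.disjoint_iff_inter_eq_empty.2 hdisj)]

/-- links of faces of a strongly shellable complex are strongly shellable. -/
theorem stmt4 [DecidableEq α] (Δ : Finset (Finset α)) (hΔ : IsComplex Δ)
    (hss : StronglyShellable Δ) (A : Finset α) (hA : A ∈ Δ) :
    StronglyShellable (link Δ A) := by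
  obtain ⟨L, hnd, hmem, hshell⟩ := hss
  let R : Finset α → Finset α → Finset α → Prop := fun F G H =>
    (F \ H).card = 1 ∧ F \ H ⊆ F \ G ∧ H \ F ⊆ G
  have hR := (List.forall_lt_exists_lt_get_iff R L).1 hshell
  refine ⟨(L.filter (A ⊆ ·)).map (· \ A), ?_, fun B => ?_,
    (List.forall_lt_exists_lt_get_iff R _).2 fun P F S hdecomp G hG => ?_⟩
  · refine (hnd.filter _).map_on fun F hF G hG hFG => ?_
    have hAF : A ⊆ F := by simpa using (List.mem_filter.1 hF).2
    have hAG : A ⊆ G := by simpa using (List.mem_filter.1 hG).2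
    rw [← Finset.sdiff_union_of_subset hAF, hFG, Finset.sdiff_union_of_subset hAG]
  · simp [isFacet_link_iff hΔ, hmem, and_assoc]
  · obtain ⟨P', T, hfilter, rfl, hT⟩ := List.map_eq_append_iff.1 hdecomp
    obtain ⟨F', S', rfl, rfl, -⟩ := List.map_eq_cons_iff.1 hT
    obtain ⟨P₁, T₁, rfl, rfl, hT₁⟩ := List.filter_eq_append_iff.1 hfilter
    obtain ⟨Q, S₁, rfl, hQ, hAF, -⟩ := List.filter_eq_cons_iff.1 hT₁
    obtain ⟨G', hG', rfl⟩ := List.mem_map.1 hG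
    obtain ⟨hG', hAG⟩ := List.mem_filter.1 hG'
    obtain ⟨H, hH, hcard, hsub, hsub'⟩ :=
      hR (P₁ ++ Q) F' S₁ (by simp) G' (List.mem_append_left _ hG')
    have hAF : A ⊆ F' := by simpa using hAF
    have hAG : A ⊆ G' := by simpa using hAG
    have hAH : A ⊆ H := fun x hx => by
      by_contra hxH
      exact (Finset.mem_sdiff.1 (hsub (Finset.mem_sdiff.2 ⟨hAF hx, hxH⟩))).2 (hAG hx)
    have hHP : H ∈ P₁ := (List.mem_append.1 hH).resolve_right fun h => hQ H h (by simpa using hAH)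
    refine ⟨H \ A, List.mem_map.2 ⟨H, List.mem_filter.2 ⟨hHP, by simpa using hAH⟩, rfl⟩, ?_⟩
    simp only [R, sdiff_sdiff_sdiff_cancel_right hAF, sdiff_sdiff_sdiff_cancel_right hAH,
      sdiff_sdiff_sdiff_cancel_right hAG]
    exact ⟨hcard, hsub, Finset.subset_sdiff.2
      ⟨hsub', Finset.sdiff_disjoint.mono_right hAF⟩⟩
end

section
/- Let Δ be a strongly shellable simplicial complex and let S be a subset of the vertex set of Δ such that for every facet σ of Δ, the intersection σ ∩ S is a facet of the restriction Δ[S]. Then Δ[S] is strongly shellable. -/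
variable {α : Type*}

/-- Removing repeated entries of a list while keeping first occurrences: if every first
occurrence `x` is related by `P` to each of its predecessors `a` through a predecessor `b`,
then the resulting list has this property at every entry. -/
theorem exists_nodup_of_first_occurrence {β : Type*} (P : β → β → β → Prop) (M : List β)
    (h : ∀ A x, A ++ [x] <+: M → x ∉ A → ∀ a ∈ A, ∃ b ∈ A, P a b x) :
    ∃ L : List β, L.Nodup ∧ (∀ x, x ∈ L ↔ x ∈ M) ∧
      ∀ i j : Fin L.length, i < j → ∃ k : Fin L.length, k < j ∧
        P (L.get i) (L.get k) (L.get j) := by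
  induction M using List.reverseRecOn with
  | nil => exact ⟨[], by simp, by simp, fun i => i.elim0⟩
  | append_singleton M x ih =>
    obtain ⟨L, hnd, hmem, hP⟩ := ih fun A y hA =>
      h A y (hA.trans (List.prefix_append M [x]))
    by_cases hx : x ∈ M
    · refine ⟨L, hnd, fun y => ?_, hP⟩
      rw [hmem, List.mem_append, List.mem_singleton]
      exact ⟨Or.inl, fun hy => hy.elim id fun e => e ▸ hx⟩
    · have hxL : x ∉ L := fun hxL => hx ((hmem x).1 hxL)
      refine ⟨L ++ [x], ?_, fun y => by simp [hmem], ?_⟩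
      · rw [List.nodup_append]
        exact ⟨hnd, by simp, by rintro a ha b hb rfl; simp_all⟩
      · rintro ⟨i, hi⟩ ⟨j, hj⟩ hij
        have hij' : i < j := hij
        have hj' : j < L.length + 1 := by simpa using hj
        have hiL : i < L.length := by omega
        rcases Nat.lt_succ_iff_lt_or_eq.1 hj' with hjL | rfl
        · obtain ⟨⟨k, hk⟩, hkj, hPk⟩ := hP ⟨i, hiL⟩ ⟨j, hjL⟩ hij
          refine ⟨⟨k, by simp; omega⟩, hkj, ?_⟩
          simpa [List.getElem_append_left, hiL, hjL, hk] using hPk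
        · obtain ⟨b, hb, hPb⟩ := h M x List.prefix_rfl hx L[i]
            ((hmem _).1 (List.getElem_mem hiL))
          obtain ⟨k, hk, rfl⟩ := List.getElem_of_mem ((hmem b).2 hb)
          refine ⟨⟨k, by simp; omega⟩, hk, ?_⟩
          simpa [List.getElem_append_left, hiL, hk] using hPb

/-- Every face of a finite complex lies in a facet. -/
theorem exists_isFacet_superset {Δ : Finset (Finset α)} {F : Finset α} (hF : F ∈ Δ) :
    ∃ σ, IsFacet Δ σ ∧ F ⊆ σ := by
  obtain ⟨σ, hFσ, hσ⟩ := Δ.exists_le_maximal hF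
  exact ⟨σ, ⟨hσ.1, fun G hG hle => le_antisymm hle (hσ.2 hG hle)⟩, hFσ⟩

/-- The strong shelling condition in terms of initial segments of the order. -/
theorem IsSSO.exists_of_prefix [DecidableEq α] {Δ : Finset (Finset α)} {L A : List (Finset α)}
    (hL : IsSSO Δ L) {F G : Finset α} (hA : A ++ [F] <+: L) (hG : G ∈ A) :
    ∃ K ∈ A, (F \ K).card = 1 ∧ F \ K ⊆ F \ G ∧ K \ F ⊆ G := by
  obtain ⟨B, rfl⟩ := hA
  obtain ⟨i, hi, rfl⟩ := List.getElem_of_mem hG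
  obtain ⟨⟨k, _⟩, hkj, hk⟩ := hL.2.2 ⟨i, by simp; omega⟩ ⟨A.length, by simp⟩ hi
  have hkA : k < A.length := hkj
  refine ⟨A[k], List.getElem_mem hkA, ?_⟩
  simpa [List.getElem_append_left, hi, hkA] using hk

/-- if `Δ` is strongly shellable and `S` is a set of vertices such that
for every facet `σ` of `Δ` the set `σ ∩ S` is a facet of the restriction
`Δ[S] = {F ∈ Δ : F ⊆ S}`, then `Δ[S]` is strongly shellable. -/
theorem stmt5 [DecidableEq α] (Δ : Finset (Finset α)) (hΔ : IsComplex Δ)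
    (hss : StronglyShellable Δ) (S : Finset α)
    (hres : ∀ σ, IsFacet Δ σ → IsFacet (Δ.filter (fun F => F ⊆ S)) (σ ∩ S)) :
    StronglyShellable (Δ.filter (fun F => F ⊆ S)) := by
  obtain ⟨L, hL⟩ := hss
  have hdist : ∀ X Y : Finset α, (X ∩ S) \ (Y ∩ S) = (X \ Y) ∩ S := by grind
  have hfirst : ∀ (A : List (Finset α)) (τ : Finset α), A ++ [τ] <+: L.map (· ∩ S) →
      τ ∉ A → ∀ a ∈ A, ∃ b ∈ A,
      (τ \ b).card = 1 ∧ τ \ b ⊆ τ \ a ∧ b \ τ ⊆ a := by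
    rintro A τ ⟨B, hB⟩ hτ a ha
    obtain ⟨l, B', rfl, hl, -⟩ := List.map_eq_append_iff.1 hB.symm
    obtain ⟨A', t, rfl, rfl, ht⟩ := List.map_eq_append_iff.1 hl
    obtain ⟨F, rfl, rfl⟩ := List.map_eq_singleton_iff.1 ht
    obtain ⟨G, hG, rfl⟩ := List.mem_map.1 ha
    obtain ⟨K, hK, hcard, hFG, hKF⟩ := hL.exists_of_prefix (List.prefix_append _ _) hG
    refine ⟨K ∩ S, List.mem_map.2 ⟨K, hK, rfl⟩, ?_, ?_, ?_⟩ <;> simp only [hdist]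
    rotate_left
    · exact Finset.inter_subset_inter_right hFG
    · exact Finset.inter_subset_inter_right hKF
    obtain ⟨v, hv⟩ := Finset.card_eq_one.1 hcard
    have hvS : v ∈ S := by
      by_contra hvS
      have hF := hres F ((hL.2.1 F).1 (by simp))
      have hK' := hres K ((hL.2.1 K).1 (by simp [hK]))
      have hsub : F ∩ S ⊆ K ∩ S := by
        intro x hx
        have : x ∈ F \ K ↔ x = v := by rw [hv, Finset.mem_singleton]
        grind
      exact hτ (List.mem_map.2 ⟨K, hK, (hF.2 _ hK'.1 hsub).symm⟩)
    rw [hv, Finset.singleton_inter_of_mem hvS, Finset.card_singleton]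
  obtain ⟨L', hnd, hmem, hP⟩ := exists_nodup_of_first_occurrence
    (fun G K F : Finset α => (F \ K).card = 1 ∧ F \ K ⊆ F \ G ∧ K \ F ⊆ G)
    (L.map (· ∩ S)) hfirst
  refine ⟨L', hnd, fun τ => ?_, hP⟩
  rw [hmem, List.mem_map]
  constructor
  · rintro ⟨σ, hσ, rfl⟩
    exact hres σ ((hL.2.1 σ).1 hσ)
  · intro hτ
    obtain ⟨hτΔ, hτS⟩ := Finset.mem_filter.1 hτ.1
    obtain ⟨σ, hσ, hτσ⟩ := exists_isFacet_superset hτΔ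
    exact ⟨σ, (hL.2.1 σ).2 hσ,
      (hτ.2 _ (hres σ hσ).1 (Finset.subset_inter hτσ hτS)).symm⟩
end

section
/- Let Γ and Δ be simplicial complexes on disjoint vertex sets. Then the join Γ ∗ Δ is strongly shellable if and only if both Γ and Δ are strongly shellable. -/
variable {α : Type*}

/-- The join of two complexes: `{F ∪ G : F ∈ Γ, G ∈ Δ}`. -/
def join [DecidableEq α] (Γ Δ : Finset (Finset α)) : Finset (Finset α) :=
  (Γ ×ˢ Δ).image (fun p => p.1 ∪ p.2)

/-- The vertex set of a complex. -/
def verts [DecidableEq α] (Δ : Finset (Finset α)) : Finset α := Δ.sup id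

/-- `C` witnesses the strong shelling condition for the facet `B` relative to the facet `A`. -/
def StrongExchange [DecidableEq α] (A B C : Finset α) : Prop :=
  (B \ C).card = 1 ∧ B \ C ⊆ B \ A ∧ C \ B ⊆ A

/-- `r` ranks the facets of `Δ` injectively so that sorting them by rank is a strong shelling. -/
def IsStrongRank [DecidableEq α] {ι : Type*} [LinearOrder ι] (Δ : Finset (Finset α))
    (r : Finset α → ι) : Prop :=
  (∀ A B, IsFacet Δ A → IsFacet Δ B → r A = r B → A = B) ∧
    ∀ A B, IsFacet Δ A → IsFacet Δ B → r A < r B →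
      ∃ C, IsFacet Δ C ∧ r C < r B ∧ StrongExchange A B C

theorem StronglyShellable.exists_rank [DecidableEq α] {Δ : Finset (Finset α)}
    (h : StronglyShellable Δ) : ∃ r : Finset α → ℕ, IsStrongRank Δ r := by
  obtain ⟨L, hnd, hL, hs⟩ := h
  refine ⟨L.idxOf, fun A B hA _ hAB => (List.idxOf_inj ((hL A).2 hA)).1 hAB, ?_⟩
  intro A B hA hB hAB
  have iA := List.idxOf_lt_length_iff.2 ((hL A).2 hA)
  have iB := List.idxOf_lt_length_iff.2 ((hL B).2 hB)
  obtain ⟨k, hk, hex⟩ := hs ⟨_, iA⟩ ⟨_, iB⟩ hAB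
  refine ⟨L.get k, (hL _).1 (L.get_mem k), ?_, ?_⟩
  · change L.idxOf L[k.1] < L.idxOf B
    rw [hnd.idxOf_getElem]
    exact hk
  · simpa [StrongExchange] using hex

theorem IsStrongRank.stronglyShellable [DecidableEq α] {ι : Type*} [LinearOrder ι]
    {Δ : Finset (Finset α)} {r : Finset α → ι} (h : IsStrongRank Δ r) :
    StronglyShellable Δ := by
  classical
  obtain ⟨hinj, hex⟩ := h
  let L := (Δ.filter (IsFacet Δ)).toList.insertionSort (Order.Preimage r (· ≤ ·))
  have hnd : L.Nodup := (List.perm_insertionSort _ _).nodup_iff.2 (Finset.nodup_toList _)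
  have hmem : ∀ F, F ∈ L ↔ IsFacet Δ F := fun F => by
    simp only [L, List.mem_insertionSort, Finset.mem_toList, Finset.mem_filter]
    exact ⟨And.right, fun hF => ⟨hF.1, hF⟩⟩
  have hsort : L.Pairwise (Order.Preimage r (· ≤ ·)) := List.pairwise_insertionSort _ _
  have hmono : ∀ i j : Fin L.length, i < j → r (L.get i) ≤ r (L.get j) := fun i j hij =>
    List.pairwise_iff_get.1 hsort i j hij
  have hfacet : ∀ i, IsFacet Δ (L.get i) := fun i => (hmem _).1 (L.get_mem i)
  refine ⟨L, hnd, hmem, fun i j hij => ?_⟩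
  have hlt : r (L.get i) < r (L.get j) := (hmono i j hij).lt_of_ne fun he =>
    hij.ne (hnd.injective_get (hinj _ _ (hfacet i) (hfacet j) he))
  obtain ⟨C, hC, hCj, hx⟩ := hex _ _ (hfacet i) (hfacet j) hlt
  obtain ⟨k, rfl⟩ := List.get_of_mem ((hmem C).2 hC)
  refine ⟨k, lt_of_not_ge fun hjk => ?_, hx⟩
  rcases hjk.lt_or_eq with hjk | rfl
  · exact (hmono j k hjk).not_gt hCj
  · exact lt_irrefl _ hCj

theorem IsComplex.exists_isFacet {Δ : Finset (Finset α)} (h : IsComplex Δ) :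
    ∃ F, IsFacet Δ F := by
  obtain ⟨F, hF⟩ := Δ.exists_maximal h.1
  exact ⟨F, hF.prop, fun G hG hFG => hF.eq_of_le hG hFG⟩

theorem subset_verts [DecidableEq α] {Δ : Finset (Finset α)} {F : Finset α} (hF : F ∈ Δ) :
    F ⊆ verts Δ :=
  Finset.le_sup (f := id) hF

theorem mem_join_iff [DecidableEq α] {Γ Δ : Finset (Finset α)} {H : Finset α} :
    H ∈ join Γ Δ ↔ ∃ F G, (F ∈ Γ ∧ G ∈ Δ) ∧ F ∪ G = H := by
  simp only [join, Finset.mem_image, Finset.mem_product, Prod.exists]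

theorem join_comm [DecidableEq α] (Γ Δ : Finset (Finset α)) : join Γ Δ = join Δ Γ := by
  ext H
  rw [mem_join_iff, mem_join_iff]
  constructor <;> rintro ⟨F, G, ⟨hF, hG⟩, rfl⟩ <;> exact ⟨G, F, ⟨hG, hF⟩, Finset.union_comm _ _⟩

theorem union_mem_join [DecidableEq α] {Γ Δ : Finset (Finset α)} {F G : Finset α}
    (hF : F ∈ Γ) (hG : G ∈ Δ) : F ∪ G ∈ join Γ Δ :=
  mem_join_iff.2 ⟨F, G, ⟨hF, hG⟩, rfl⟩

theorem union_inter_verts_left [DecidableEq α] {Γ Δ : Finset (Finset α)}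
    (hd : Disjoint (verts Γ) (verts Δ)) {F G : Finset α} (hF : F ∈ Γ) (hG : G ∈ Δ) :
    (F ∪ G) ∩ verts Γ = F := by
  rw [Finset.union_inter_distrib_right, Finset.inter_eq_left.2 (subset_verts hF),
    Finset.disjoint_iff_inter_eq_empty.1 (hd.symm.mono_left (subset_verts hG)),
    Finset.union_empty]

theorem union_inter_verts_right [DecidableEq α] {Γ Δ : Finset (Finset α)}
    (hd : Disjoint (verts Γ) (verts Δ)) {F G : Finset α} (hF : F ∈ Γ) (hG : G ∈ Δ) :
    (F ∪ G) ∩ verts Δ = G := by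
  rw [Finset.union_comm, union_inter_verts_left hd.symm hG hF]

theorem isFacet_join_iff [DecidableEq α] {Γ Δ : Finset (Finset α)}
    (hd : Disjoint (verts Γ) (verts Δ)) {H : Finset α} :
    IsFacet (join Γ Δ) H ↔ ∃ F G, IsFacet Γ F ∧ IsFacet Δ G ∧ F ∪ G = H := by
  constructor
  · rintro ⟨hH, hmax⟩
    obtain ⟨F, G, ⟨hF, hG⟩, rfl⟩ := mem_join_iff.1 hH
    refine ⟨F, G, ⟨hF, fun F' hF' hs => ?_⟩, ⟨hG, fun G' hG' hs => ?_⟩, rfl⟩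
    · have := hmax _ (union_mem_join hF' hG) (Finset.union_subset_union_left hs)
      rw [← union_inter_verts_left hd hF hG, ← union_inter_verts_left hd hF' hG, ← this]
    · have := hmax _ (union_mem_join hF hG') (Finset.union_subset_union_right hs)
      rw [← union_inter_verts_right hd hF hG, ← union_inter_verts_right hd hF hG', ← this]
  · rintro ⟨F, G, hF, hG, rfl⟩
    refine ⟨union_mem_join hF.1 hG.1, fun H hH hs => ?_⟩
    obtain ⟨F', G', ⟨hF', hG'⟩, rfl⟩ := mem_join_iff.1 hH
    have h1 := Finset.inter_subset_inter_right (u := verts Γ) hs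
    have h2 := Finset.inter_subset_inter_right (u := verts Δ) hs
    rw [union_inter_verts_left hd hF.1 hG.1, union_inter_verts_left hd hF' hG'] at h1
    rw [union_inter_verts_right hd hF.1 hG.1, union_inter_verts_right hd hF' hG'] at h2
    rw [hF.2 _ hF' h1, hG.2 _ hG' h2]

/-- Strong exchange survives enlarging `B` and `C` by a common set and `A` by another one,
provided both are disjoint from `B`. -/
theorem StrongExchange.union_right [DecidableEq α] {A B C D E : Finset α}
    (h : StrongExchange A B C) (hBD : Disjoint B D) (hBE : Disjoint B E) :
    StrongExchange (A ∪ E) (B ∪ D) (C ∪ D) := by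
  have key : (B ∪ D) \ (C ∪ D) = B \ C := by
    ext x
    have : x ∈ B → x ∉ D := fun h => Finset.disjoint_left.1 hBD h
    simp only [Finset.mem_sdiff, Finset.mem_union]
    tauto
  refine ⟨key ▸ h.1, ?_, ?_⟩
  · rw [key]
    intro x hx
    have h1 := h.2.1 hx
    have : x ∈ B → x ∉ E := fun h => Finset.disjoint_left.1 hBE h
    simp only [Finset.mem_sdiff, Finset.mem_union] at *
    tauto
  · intro x hx
    have h1 : x ∈ C \ B → x ∈ A := fun hx => h.2.2 hx
    simp only [Finset.mem_sdiff, Finset.mem_union] at *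
    tauto

theorem StronglyShellable.of_join_left [DecidableEq α] {Γ Δ : Finset (Finset α)}
    (hΔ : IsComplex Δ) (hd : Disjoint (verts Γ) (verts Δ))
    (h : StronglyShellable (join Γ Δ)) : StronglyShellable Γ := by
  obtain ⟨r, hinj, hex⟩ := h.exists_rank
  obtain ⟨G, hG⟩ := hΔ.exists_isFacet
  have hjoin : ∀ F, IsFacet Γ F → IsFacet (join Γ Δ) (F ∪ G) := fun F hF =>
    (isFacet_join_iff hd).2 ⟨F, G, hF, hG, rfl⟩
  have hdisj : ∀ {F G}, F ∈ Γ → G ∈ Δ → Disjoint F G := fun hF hG =>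
    hd.mono (subset_verts hF) (subset_verts hG)
  refine IsStrongRank.stronglyShellable (r := fun F => r (F ∪ G)) ⟨fun A B hA hB hAB => ?_,
    fun A B hA hB hAB => ?_⟩
  · have := hinj _ _ (hjoin A hA) (hjoin B hB) hAB
    rw [← union_inter_verts_left hd hA.1 hG.1, this, union_inter_verts_left hd hB.1 hG.1]
  · obtain ⟨H, hH, hlt, hcard, hsub, hsub'⟩ := hex _ _ (hjoin A hA) (hjoin B hB) hAB
    obtain ⟨C, G', hC, hG', rfl⟩ := (isFacet_join_iff hd).1 hH
    have hGG : G' ⊆ G := fun x hx => by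
      have h1 := @hsub' x
      have h2 := Finset.disjoint_right.1 (hdisj hA.1 hG'.1) hx
      have h3 := Finset.disjoint_right.1 (hdisj hB.1 hG'.1) hx
      simp only [Finset.mem_sdiff, Finset.mem_union] at *
      tauto
    obtain rfl : G' = G := hG'.2 _ hG.1 hGG
    have key : (B ∪ G') \ (C ∪ G') = B \ C := by
      ext x
      have : x ∈ B → x ∉ G' := fun h => Finset.disjoint_left.1 (hdisj hB.1 hG'.1) h
      simp only [Finset.mem_sdiff, Finset.mem_union]
      tauto
    rw [key] at hcard hsub
    refine ⟨C, hC, hlt, hcard, fun x hx => ?_, fun x hx => ?_⟩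
    · have h1 := hsub hx
      simp only [Finset.mem_sdiff, Finset.mem_union] at *
      tauto
    · have h1 := @hsub' x
      have h2 : x ∈ C → x ∉ G' := fun h => Finset.disjoint_left.1 (hdisj hC.1 hG'.1) h
      simp only [Finset.mem_sdiff, Finset.mem_union] at *
      tauto

theorem StronglyShellable.join [DecidableEq α] {Γ Δ : Finset (Finset α)}
    (hd : Disjoint (verts Γ) (verts Δ)) (hΓ : StronglyShellable Γ)
    (hΔ : StronglyShellable Δ) : StronglyShellable (join Γ Δ) := by
  obtain ⟨r, hr, hrx⟩ := hΓ.exists_rank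
  obtain ⟨s, hs, hsx⟩ := hΔ.exists_rank
  have hdisj : ∀ {F G}, F ∈ Γ → G ∈ Δ → Disjoint F G := fun hF hG =>
    hd.mono (subset_verts hF) (subset_verts hG)
  let t : Finset α → ℕ ×ₗ ℕ := fun H => toLex (r (H ∩ verts Γ), s (H ∩ verts Δ))
  have ht : ∀ {F G}, IsFacet Γ F → IsFacet Δ G → t (F ∪ G) = toLex (r F, s G) :=
    fun hF hG => by
      simp only [t, union_inter_verts_left hd hF.1 hG.1, union_inter_verts_right hd hF.1 hG.1]
  refine IsStrongRank.stronglyShellable (r := t) ⟨fun H K hH hK hHK => ?_,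
    fun H K hH hK hHK => ?_⟩ <;>
  obtain ⟨F, G, hF, hG, rfl⟩ := (isFacet_join_iff hd).1 hH <;>
  obtain ⟨F', G', hF', hG', rfl⟩ := (isFacet_join_iff hd).1 hK <;>
  rw [ht hF hG, ht hF' hG'] at hHK
  · obtain ⟨h1, h2⟩ := Prod.ext_iff.1 (toLex_inj.1 hHK)
    rw [hr _ _ hF hF' h1, hs _ _ hG hG' h2]
  · rcases Prod.Lex.toLex_lt_toLex.1 hHK with hlt | ⟨-, hlt⟩
    · obtain ⟨C, hC, hlt', hx⟩ := hrx _ _ hF hF' hlt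
      refine ⟨C ∪ G', (isFacet_join_iff hd).2 ⟨C, G', hC, hG', rfl⟩, ?_,
        hx.union_right (hdisj hF'.1 hG'.1) (hdisj hF'.1 hG.1)⟩
      rw [ht hC hG', ht hF' hG']
      exact Prod.Lex.toLex_lt_toLex.2 (Or.inl hlt')
    · obtain ⟨C, hC, hlt', hx⟩ := hsx _ _ hG hG' hlt
      refine ⟨F' ∪ C, (isFacet_join_iff hd).2 ⟨F', C, hF', hC, rfl⟩, ?_, ?_⟩
      · rw [ht hF' hC, ht hF' hG']
        exact Prod.Lex.toLex_lt_toLex.2 (Or.inr ⟨rfl, hlt'⟩)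
      · rw [Finset.union_comm F, Finset.union_comm F', Finset.union_comm F']
        exact hx.union_right (hdisj hF'.1 hG'.1).symm (hdisj hF.1 hG'.1).symm

/-- for complexes `Γ`, `Δ` on disjoint vertex sets, the join `Γ ∗ Δ`
is strongly shellable iff both `Γ` and `Δ` are. -/
theorem stmt6 [DecidableEq α] (Γ Δ : Finset (Finset α))
    (hΓ : IsComplex Γ) (hΔ : IsComplex Δ)
    (hdisj : Disjoint (verts Γ) (verts Δ)) :
    StronglyShellable (join Γ Δ) ↔ StronglyShellable Γ ∧ StronglyShellable Δ :=
  ⟨fun h => ⟨h.of_join_left hΔ hdisj,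
    StronglyShellable.of_join_left hΓ hdisj.symm (join_comm Γ Δ ▸ h)⟩,
    fun h => h.1.join hdisj h.2⟩
end

section
/- Let Δ be a simplicial complex on vertex set {x₁, …, x_n} and let s₁, …, s_n be positive integers. Then Δ is strongly shellable if and only if the expansion Δ^{(s₁,…,s_n)} is strongly shellable. -/
variable {α : Type*}

/-- The `(s₁,…,s_n)`-expansion of `Δ`: faces are the sets `T` of pairs `(i, j)` with
`1 ≤ j ≤ s i`, whose first coordinates are pairwise distinct and form a face of `Δ`.
Its facets are exactly the sets `{(i, rᵢ) : i ∈ F}` with `F` a facet of `Δ` and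
`1 ≤ rᵢ ≤ s i`. -/
def expansion [DecidableEq α] (Δ : Finset (Finset α)) (s : α → ℕ) :
    Finset (Finset (α × ℕ)) :=
  (((Δ.sup id).biUnion (fun i => (Finset.Icc 1 (s i)).image (fun j => (i, j)))).powerset).filter
    (fun T => T.image Prod.fst ∈ Δ ∧ ∀ p ∈ T, ∀ q ∈ T, p.1 = q.1 → p = q)

/-- `K` witnesses the strong shelling condition for the facets `A` (earlier) and `B` (later). -/
def StrongLink [DecidableEq α] (A B K : Finset α) : Prop :=
  (B \ K).card = 1 ∧ B \ K ⊆ B \ A ∧ K \ B ⊆ A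

/-- Sorting the facets by a rank function, ties being broken arbitrarily, gives a strong
shelling order as soon as every pair of facets has a witness of strictly smaller rank. -/
theorem StronglyShellable.of_rank [DecidableEq α] {γ : Type*} [LinearOrder γ]
    {Δ : Finset (Finset α)} (rank : Finset α → γ)
    (h : ∀ A B, IsFacet Δ A → IsFacet Δ B → A ≠ B → rank A ≤ rank B →
      ∃ K, IsFacet Δ K ∧ rank K < rank B ∧ StrongLink A B K) :
    StronglyShellable Δ := by
  classical
  let r : Finset α → Finset α → Prop := fun A B => rank A ≤ rank B
  have : Std.Total r := ⟨fun A B => le_total _ _⟩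
  have : IsTrans _ r := ⟨fun A B C hAB hBC => le_trans hAB hBC⟩
  let L := (Δ.filter (IsFacet Δ)).toList.insertionSort r
  have hmem : ∀ F, F ∈ L ↔ IsFacet Δ F := by
    intro F
    simp only [L, List.mem_insertionSort, Finset.mem_toList, Finset.mem_filter]
    exact ⟨fun hF => hF.2, fun hF => ⟨hF.1, hF⟩⟩
  have hnodup : L.Nodup :=
    (List.perm_insertionSort r _).nodup_iff.mpr (Finset.nodup_toList _)
  have hsorted : L.Pairwise r := List.pairwise_insertionSort r _
  have hrank : ∀ i j : Fin L.length, i < j → rank (L.get i) ≤ rank (L.get j) :=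
    List.pairwise_iff_get.mp hsorted
  refine ⟨L, hnodup, hmem, fun i j hij => ?_⟩
  obtain ⟨K, hK, hlt, hlink⟩ := h (L.get i) (L.get j) ((hmem _).mp (L.get_mem i))
    ((hmem _).mp (L.get_mem j)) (fun he => hij.ne (hnodup.injective_get he)) (hrank i j hij)
  obtain ⟨k, rfl⟩ := List.mem_iff_get.mp ((hmem K).mpr hK)
  refine ⟨k, ?_, hlink⟩
  by_contra! hjk
  rcases hjk.eq_or_lt with rfl | hjk
  · exact hlt.false
  · exact (hrank j k hjk).not_gt hlt

theorem StronglyShellable.exists_rank_s7 [DecidableEq α] {Δ : Finset (Finset α)}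
    (h : StronglyShellable Δ) :
    ∃ rank : Finset α → ℕ, ∀ A B, IsFacet Δ A → IsFacet Δ B → A ≠ B → rank A ≤ rank B →
      ∃ K, IsFacet Δ K ∧ rank K < rank B ∧ StrongLink A B K := by
  obtain ⟨L, hnodup, hmem, hL⟩ := h
  refine ⟨fun F => L.idxOf F, fun A B hA hB hne hle => ?_⟩
  obtain ⟨i, rfl⟩ := List.mem_iff_get.mp ((hmem A).mpr hA)
  obtain ⟨j, rfl⟩ := List.mem_iff_get.mp ((hmem B).mpr hB)
  simp only [List.get_eq_getElem, hnodup.idxOf_getElem] at hle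
  have hij : i < j := lt_of_le_of_ne hle (fun he => hne (by rw [he]))
  obtain ⟨k, hkj, hlink⟩ := hL i j hij
  refine ⟨L.get k, (hmem _).mp (L.get_mem k), ?_, hlink⟩
  simpa only [List.get_eq_getElem, hnodup.idxOf_getElem, Fin.lt_def] using hkj

theorem mem_expansion [DecidableEq α] {Δ : Finset (Finset α)} {s : α → ℕ}
    {T : Finset (α × ℕ)} :
    T ∈ expansion Δ s ↔ (∀ p ∈ T, 1 ≤ p.2 ∧ p.2 ≤ s p.1) ∧ T.image Prod.fst ∈ Δ ∧
      ∀ p ∈ T, ∀ q ∈ T, p.1 = q.1 → p = q := by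
  simp only [expansion, Finset.mem_filter, Finset.mem_powerset]
  refine and_congr_left fun ⟨hΔ, _⟩ => ⟨fun h p hp => ?_, fun h p hp => ?_⟩
  · have := h hp
    simp only [Finset.mem_biUnion, Finset.mem_image, Finset.mem_Icc] at this
    obtain ⟨i, -, j, hj, rfl⟩ := this
    exact hj
  · simp only [Finset.mem_biUnion, Finset.mem_image, Finset.mem_Icc]
    exact ⟨p.1, Finset.mem_sup.mpr ⟨_, hΔ, Finset.mem_image_of_mem _ hp⟩, p.2, h p hp, rfl⟩

theorem isFacet_expansion_iff [DecidableEq α] {Δ : Finset (Finset α)} {s : α → ℕ}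
    (hs : ∀ i, 1 ≤ s i) {T : Finset (α × ℕ)} :
    IsFacet (expansion Δ s) T ↔ (∀ p ∈ T, 1 ≤ p.2 ∧ p.2 ≤ s p.1) ∧
      IsFacet Δ (T.image Prod.fst) ∧ ∀ p ∈ T, ∀ q ∈ T, p.1 = q.1 → p = q := by
  constructor
  · rintro ⟨hT, hmax⟩
    obtain ⟨hbound, hface, hinj⟩ := mem_expansion.mp hT
    refine ⟨hbound, ⟨hface, fun G hG hTG => ?_⟩, hinj⟩
    let T' := T ∪ (G \ T.image Prod.fst) ×ˢ {1}
    have himage : T'.image Prod.fst = G := by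
      ext x
      constructor
      · intro hx
        obtain ⟨p, hp, rfl⟩ := Finset.mem_image.mp hx
        rcases Finset.mem_union.mp hp with hp | hp
        · exact hTG (Finset.mem_image_of_mem _ hp)
        · exact (Finset.mem_sdiff.mp (Finset.mem_product.mp hp).1).1
      · intro hx
        by_cases hxT : x ∈ T.image Prod.fst
        · exact Finset.image_subset_image Finset.subset_union_left hxT
        · exact Finset.mem_image.mpr ⟨(x, 1), by grind, rfl⟩
    have hT' : T' ∈ expansion Δ s := by
      refine mem_expansion.mpr ⟨?_, himage ▸ hG, ?_⟩
      · intro p hp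
        have := hs p.1
        grind
      · rintro ⟨x, a⟩ hp ⟨y, b⟩ hq hxy
        have := hinj (x, a)
        grind
    rw [← himage, ← hmax T' hT' Finset.subset_union_left]
  · rintro ⟨hbound, ⟨hface, hmax⟩, hinj⟩
    refine ⟨mem_expansion.mpr ⟨hbound, hface, hinj⟩, fun T' hT' hsub => hsub.antisymm ?_⟩
    obtain ⟨-, hface', hinj'⟩ := mem_expansion.mp hT'
    intro p hp
    have hp1 := Finset.mem_image_of_mem Prod.fst hp
    rw [← hmax _ hface' (Finset.image_subset_image hsub)] at hp1
    obtain ⟨q, hq, hqp⟩ := Finset.mem_image.mp hp1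
    rwa [← hinj' q (hsub hq) p hp hqp]

/-- Two distinct sections over the same base set, the first of no larger total height, differ
at some point where the first is strictly lower. -/
theorem exists_lower_of_sum_le [DecidableEq α] {A B : Finset (α × ℕ)}
    (hA : ∀ p ∈ A, ∀ q ∈ A, p.1 = q.1 → p = q) (hB : ∀ p ∈ B, ∀ q ∈ B, p.1 = q.1 → p = q)
    (himage : A.image Prod.fst = B.image Prod.fst) (hne : A ≠ B)
    (hsum : ∑ p ∈ A, p.2 ≤ ∑ p ∈ B, p.2) :
    ∃ a ∈ A, ∃ b ∈ B, a.1 = b.1 ∧ a.2 < b.2 := by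
  by_contra! hcon
  have hex : ∀ b ∈ B, ∃ a ∈ A, a.1 = b.1 := fun b hb =>
    Finset.mem_image.mp (himage ▸ Finset.mem_image_of_mem Prod.fst hb)
  have hex' : ∀ a ∈ A, ∃ b ∈ B, b.1 = a.1 := fun a ha =>
    Finset.mem_image.mp (himage ▸ Finset.mem_image_of_mem Prod.fst ha)
  choose! g hgA hg using hex
  have hsum' : ∑ b ∈ B, (g b).2 = ∑ a ∈ A, a.2 := by
    refine Finset.sum_nbij g hgA ?_ ?_ (fun _ _ => rfl)
    · intro b hb c hc hbc
      exact hB b hb c hc (by rw [← hg b hb, ← hg c hc, hbc])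
    · intro a ha
      obtain ⟨b, hb, hba⟩ := hex' a ha
      exact ⟨b, hb, hA _ (hgA b hb) a ha ((hg b hb).trans hba)⟩
  have hle : ∀ b ∈ B, b.2 ≤ (g b).2 := fun b hb => hcon _ (hgA b hb) b hb (hg b hb)
  have heq := (Finset.sum_eq_sum_iff_of_le hle).mp
    ((Finset.sum_le_sum hle).antisymm (hsum'.trans_le hsum))
  have hfix : ∀ b ∈ B, g b = b := fun b hb => Prod.ext (hg b hb) (heq b hb).symm
  refine hne (Finset.Subset.antisymm (fun a ha => ?_) fun b hb => hfix b hb ▸ hgA b hb)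
  obtain ⟨b, hb, hba⟩ := hex' a ha
  rwa [← hA b (hfix b hb ▸ hgA b hb) a ha hba]

theorem StronglyShellable.expansion [DecidableEq α] {Δ : Finset (Finset α)}
    (h : StronglyShellable Δ) {s : α → ℕ} (hs : ∀ i, 1 ≤ s i) :
    StronglyShellable (expansion Δ s) := by
  obtain ⟨rank, hrank⟩ := h.exists_rank_s7
  refine StronglyShellable.of_rank
    (fun T => toLex (rank (T.image Prod.fst), ∑ p ∈ T, p.2)) fun A B hA hB hne hle => ?_
  obtain ⟨hAbound, hAfacet, hAinj⟩ := (isFacet_expansion_iff hs).mp hA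
  obtain ⟨hBbound, hBfacet, hBinj⟩ := (isFacet_expansion_iff hs).mp hB
  simp only [Prod.Lex.toLex_le_toLex] at hle
  by_cases himage : A.image Prod.fst = B.image Prod.fst
  · obtain ⟨⟨x, a⟩, ha, ⟨y, b⟩, hb, rfl, hab⟩ := exists_lower_of_sum_le hAinj hBinj himage hne
      (by simpa [himage] using hle)
    have haB : (x, a) ∉ B := fun h => hab.ne (congrArg Prod.snd (hBinj _ h _ hb rfl))
    have hbA : (x, b) ∉ A := fun h => hab.ne (congrArg Prod.snd (hAinj _ ha _ h rfl))
    let K := insert (x, a) (B.erase (x, b))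
    have hK : K.image Prod.fst = B.image Prod.fst := by
      rw [Finset.image_insert]
      conv_rhs => rw [← Finset.insert_erase hb, Finset.image_insert]
    refine ⟨K, (isFacet_expansion_iff hs).mpr ⟨?_, hK ▸ hBfacet, ?_⟩, ?_, ?_, ?_, ?_⟩
    · grind
    · rintro ⟨y, c⟩ hy ⟨z, d⟩ hz hyz
      have h₁ := hBinj (y, c)
      have h₂ := hBinj (x, b)
      grind
    · rw [Prod.Lex.toLex_lt_toLex]
      refine Or.inr ⟨congrArg rank hK, ?_⟩
      change ∑ p ∈ K, p.2 < ∑ p ∈ B, p.2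
      rw [Finset.sum_insert (fun h => haB (Finset.mem_of_mem_erase h)),
        ← Finset.add_sum_erase B _ hb]
      exact Nat.add_lt_add_right hab _
    · refine Finset.card_eq_one.mpr ⟨(x, b), ?_⟩
      grind
    · grind
    · grind
  · obtain ⟨G, hG, hlt, hcard, hsub, hsub'⟩ := hrank _ _ hAfacet hBfacet himage
      (hle.elim le_of_lt fun h => h.1.le)
    obtain ⟨x, hx⟩ := Finset.card_eq_one.mp hcard
    have hxmem : x ∈ B.image Prod.fst \ G := hx ▸ Finset.mem_singleton_self x
    let K := B.filter (fun p => p.1 ∈ G) ∪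
      A.filter (fun p => p.1 ∈ G \ B.image Prod.fst)
    have hK : K.image Prod.fst = G := by
      ext y
      constructor
      · intro hy
        obtain ⟨p, hp, rfl⟩ := Finset.mem_image.mp hy
        grind
      · intro hy
        by_cases hyB : y ∈ B.image Prod.fst
        · obtain ⟨p, hp, rfl⟩ := Finset.mem_image.mp hyB
          exact Finset.mem_image_of_mem _
            (Finset.mem_union_left _ (Finset.mem_filter.mpr ⟨hp, hy⟩))
        · have hyG := Finset.mem_sdiff.mpr ⟨hy, hyB⟩
          obtain ⟨p, hp, rfl⟩ := Finset.mem_image.mp (hsub' hyG)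
          exact Finset.mem_image_of_mem _
            (Finset.mem_union_right _ (Finset.mem_filter.mpr ⟨hp, hyG⟩))
    have hBK : ∀ p, p ∈ B \ K ↔ p ∈ B ∧ p.1 = x := by
      intro p
      have hxp : p.1 ∈ B.image Prod.fst \ G ↔ p.1 = x := by rw [hx, Finset.mem_singleton]
      have := Finset.mem_image_of_mem Prod.fst (s := B) (a := p)
      grind
    refine ⟨K, (isFacet_expansion_iff hs).mpr ⟨?_, hK.symm ▸ hG, ?_⟩, ?_, ?_, ?_, ?_⟩
    · grind
    · intro p hp q hq hpq
      have h₁ := Finset.mem_image_of_mem Prod.fst (s := B) (a := p)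
      have h₂ := Finset.mem_image_of_mem Prod.fst (s := B) (a := q)
      grind
    · rw [Prod.Lex.toLex_lt_toLex]
      exact Or.inl (hK.symm ▸ hlt)
    · obtain ⟨p, hp, hpx⟩ := Finset.mem_image.mp (Finset.mem_sdiff.mp hxmem).1
      refine Finset.card_eq_one.mpr ⟨p, ?_⟩
      ext q
      rw [hBK, Finset.mem_singleton]
      exact ⟨fun hq => hBinj q hq.1 p hp (hq.2.trans hpx.symm), fun hq => hq ▸ ⟨hp, hpx⟩⟩
    · intro p hp
      obtain ⟨hpB, hpx⟩ := (hBK p).mp hp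
      refine Finset.mem_sdiff.mpr ⟨hpB, fun hpA => ?_⟩
      exact (Finset.mem_sdiff.mp (hsub hxmem)).2 (hpx ▸ Finset.mem_image_of_mem _ hpA)
    · grind

theorem StronglyShellable.of_expansion [DecidableEq α] {Δ : Finset (Finset α)} {s : α → ℕ}
    (hs : ∀ i, 1 ≤ s i) (h : StronglyShellable (_root_.expansion Δ s)) :
    StronglyShellable Δ := by
  obtain ⟨rank, hrank⟩ := h.exists_rank_s7
  have himage : ∀ F : Finset α, (F ×ˢ {1} : Finset (α × ℕ)).image Prod.fst = F := by
    intro F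
    ext x
    simp
  have hfacet : ∀ F, IsFacet (_root_.expansion Δ s) (F ×ˢ {1}) ↔ IsFacet Δ F := by
    intro F
    rw [isFacet_expansion_iff hs, himage]
    refine ⟨fun h => h.2.1, fun h => ⟨?_, h, ?_⟩⟩
    · rintro ⟨x, a⟩ hp
      have := hs x
      grind
    · rintro ⟨x, a⟩ hp ⟨y, b⟩ hq hxy
      grind
  refine StronglyShellable.of_rank (fun F => rank (F ×ˢ {1})) fun A B hA hB hne hle => ?_
  obtain ⟨K, hK, hlt, hcard, hsub, hsub'⟩ := hrank _ _ ((hfacet A).mpr hA) ((hfacet B).mpr hB)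
    (fun he => hne (by rw [← himage A, he, himage])) hle
  have hone : ∀ p ∈ K, p.2 = 1 := by
    intro p hp
    have := @hsub' p
    grind
  obtain ⟨G, rfl⟩ : ∃ G : Finset α, G ×ˢ {1} = K := by
    refine ⟨K.image Prod.fst, ?_⟩
    ext ⟨x, a⟩
    simp only [Finset.mem_product, Finset.mem_image, Finset.mem_singleton]
    constructor
    · rintro ⟨⟨p, hp, rfl⟩, rfl⟩
      rw [← hone p hp]
      exact hp
    · intro hp
      exact ⟨⟨_, hp, rfl⟩, hone _ hp⟩
  refine ⟨G, (hfacet G).mp hK, hlt, ?_, ?_, ?_⟩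
  · have hdiff : (B ×ˢ {1} : Finset (α × ℕ)) \ G ×ˢ {1} = (B \ G) ×ˢ {1} := by grind
    rwa [hdiff, Finset.card_product, Finset.card_singleton, mul_one] at hcard
  · intro x hx
    have := @hsub (x, 1)
    grind
  · intro x hx
    have := @hsub' (x, 1)
    grind

/-- `Δ` is strongly shellable iff its `(s₁,…,s_n)`-expansion is. -/
theorem stmt7 [DecidableEq α] (Δ : Finset (Finset α)) (hΔ : IsComplex Δ)
    (s : α → ℕ) (hs : ∀ i, 1 ≤ s i) :
    StronglyShellable Δ ↔ StronglyShellable (expansion Δ s) :=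
  ⟨fun h => h.expansion hs, StronglyShellable.of_expansion hs⟩
end

section
/- Let F, G, H be finite sets with min(|F|, |G|) ≤ |H| ≤ max(|F|, |G|). Then dis(F, H) + dis(H, G) = dis(F, G) if and only if F ∩ G ⊆ H ⊆ F ∪ G, where dis(A, B) := min(|A ∖ B|, |B ∖ A|). -/
variable {α : Type*}

/-- The distance between two finite sets: `min(|A ∖ B|, |B ∖ A|)`. -/
def dis [DecidableEq α] (A B : Finset α) : ℕ := min (A \ B).card (B \ A).card

/-- Split `A \ B` according to membership in `C`. -/
theorem card_sdiff_eq_card_sdiff_union_add [DecidableEq α] (A B C : Finset α) :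
    (A \ B).card = (A \ (B ∪ C)).card + ((A ∩ C) \ B).card := by
  rw [← Finset.card_sdiff_add_card_inter (A \ B) C, sdiff_sdiff_left,
    Finset.sdiff_inter_right_comm, Finset.sup_eq_union]

/-- for finite sets with `min(|F|,|G|) ≤ |H| ≤ max(|F|,|G|)`,
`dis(F,H) + dis(H,G) = dis(F,G)` iff `F ∩ G ⊆ H ⊆ F ∪ G`. -/
theorem stmt8 [DecidableEq α] (F G H : Finset α)
    (h1 : min F.card G.card ≤ H.card) (h2 : H.card ≤ max F.card G.card) :
    dis F H + dis H G = dis F G ↔ F ∩ G ⊆ H ∧ H ⊆ F ∪ G := by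
  have sub_inter : F ∩ G ⊆ H ↔ ((F ∩ G) \ H).card = 0 := by
    rw [Finset.card_eq_zero, Finset.sdiff_eq_empty_iff_subset]
  have sub_union : H ⊆ F ∪ G ↔ (H \ (F ∪ G)).card = 0 := by
    rw [Finset.card_eq_zero, Finset.sdiff_eq_empty_iff_subset]
  have hFG := card_sdiff_eq_card_sdiff_union_add F G H
  have hGF := card_sdiff_eq_card_sdiff_union_add G F H
  have hFH := card_sdiff_eq_card_sdiff_union_add F H G
  have hHF := card_sdiff_eq_card_sdiff_union_add H F G
  have hGH := card_sdiff_eq_card_sdiff_union_add G H F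
  have hHG := card_sdiff_eq_card_sdiff_union_add H G F
  rw [Finset.union_comm H G] at hFH
  rw [Finset.union_comm H F, Finset.inter_comm G F] at hGH
  rw [Finset.union_comm G F, Finset.inter_comm H F] at hHG
  rw [Finset.inter_comm H G] at hHF
  have cFH := Finset.card_sdiff_add_card F H
  have cHF := Finset.card_sdiff_add_card H F
  have cGH := Finset.card_sdiff_add_card G H
  have cHG := Finset.card_sdiff_add_card H G
  rw [Finset.union_comm H F] at cHF
  rw [Finset.union_comm H G] at cHG
  rw [sub_inter, sub_union]
  unfold dis
  omega
end

section
/- Suppose the simplicial complex Δ is quasi-harmonious with respect to the dimension-decreasing strong shelling order ≻ on F(Δ). Then for each pair of facets F_i ≻ F_j there exists a sequence of facets F_i = G₀, G₁, …, G_t = F_j such that (a) t = dis(F_i, F_j), (b) dim(G₀) ≥ dim(G₁) ≥ ⋯ ≥ dim(G_t), and (c) dis(G_h, G_{h+1}) = 1 for each 0 ≤ h ≤ t − 1. -/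
variable {α : Type*}

/-- There is a sequence of `n + 1` facets of `Δ` from `A` to `B`, of weakly decreasing
cardinality, with consecutive distances `1`. -/
def HasDescendingPath [DecidableEq α] (Δ : Finset (Finset α)) (n : ℕ) (A B : Finset α) : Prop :=
  ∃ G : ℕ → Finset α, G 0 = A ∧ G n = B ∧ (∀ h ≤ n, IsFacet Δ (G h)) ∧
    ∀ h < n, (G (h + 1)).card ≤ (G h).card ∧ dis (G h) (G (h + 1)) = 1

theorem dis_comm [DecidableEq α] (A B : Finset α) : dis A B = dis B A :=
  min_comm _ _

theorem dis_eq_card_sdiff_of_card_le [DecidableEq α] {A B : Finset α} (h : B.card ≤ A.card) :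
    dis A B = (B \ A).card := by
  have hA := Finset.card_sdiff_add_card_inter A B
  have hB := Finset.card_sdiff_add_card_inter B A
  rw [Finset.inter_comm] at hB
  unfold dis
  omega

theorem card_sdiff_add_card_sdiff_of_between [DecidableEq α] {A B C : Finset α}
    (hl : A ∩ B ⊆ C) (hu : C ⊆ A ∪ B) :
    (C \ A).card + (B \ C).card = (B \ A).card := by
  rw [← Finset.card_union_of_disjoint]
  · congr 1
    grind
  · rw [Finset.disjoint_left]
    grind

namespace HasDescendingPath

variable [DecidableEq α] {Δ : Finset (Finset α)} {n : ℕ} {A B C : Finset α}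

theorem refl (hA : IsFacet Δ A) : HasDescendingPath Δ 0 A A :=
  ⟨fun _ => A, rfl, rfl, fun _ _ => hA, fun _ h => absurd h (Nat.not_lt_zero _)⟩

theorem snoc (hp : HasDescendingPath Δ n A B) (hC : IsFacet Δ C) (hcard : C.card ≤ B.card)
    (hdis : dis B C = 1) : HasDescendingPath Δ (n + 1) A C := by
  obtain ⟨G, h0, hn, hf, hs⟩ := hp
  refine ⟨fun h => if h ≤ n then G h else C, by simpa using h0, by simp, fun h _ => ?_,
    fun h hh => ?_⟩
  · dsimp only
    split_ifs with hle
    exacts [hf h hle, hC]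
  · rcases (Nat.lt_succ_iff.mp hh).lt_or_eq with hlt | rfl
    · simpa [hlt.le, Nat.succ_le_of_lt hlt] using hs h hlt
    · simpa [hn] using And.intro hcard hdis

theorem reverse (hp : HasDescendingPath Δ n A B) (hcard : A.card = B.card) :
    HasDescendingPath Δ n B A := by
  obtain ⟨G, h0, hn, hf, hs⟩ := hp
  have hupper : ∀ h ≤ n, (G h).card ≤ A.card := by
    intro h
    induction h with
    | zero => intro _; rw [h0]
    | succ h ih => intro hh; exact (hs h hh).1.trans (ih (by omega))
  have hlower : ∀ h ≤ n, B.card ≤ (G h).card := by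
    intro h hh
    induction hh using Nat.decreasingInduction with
    | self => rw [hn]
    | of_succ _ hh ih => exact ih.trans (hs _ hh).1
  refine ⟨fun h => G (n - h), by simpa using hn, by simpa using h0,
    fun h _ => hf _ (Nat.sub_le _ _), fun h hh => ⟨?_, ?_⟩⟩
  · exact (hupper _ (Nat.sub_le _ _)).trans (hcard.le.trans (hlower _ (Nat.sub_le _ _)))
  · have hstep := (hs (n - (h + 1)) (by omega)).2
    rw [show n - (h + 1) + 1 = n - h by omega] at hstep
    rwa [dis_comm]

end HasDescendingPath

/-- if `Δ` is quasi-harmonious with respect to the dimension-decreasing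
strong shelling order given by `L`, then for each pair of facets `F_i ≻ F_j` there is
a sequence of facets `F_i = G₀, …, G_t = F_j` with `t = dis(F_i, F_j)`, weakly
decreasing dimensions, and consecutive distances `1`. -/
theorem stmt10 [DecidableEq α] (Δ : Finset (Finset α)) (hΔ : IsComplex Δ)
    (L : List (Finset α)) (hL : IsSSO Δ L)
    (hdec : L.Chain' (fun F G => G.card ≤ F.card))
    (hqh : ∀ i j : Fin L.length, i < j → ∃ k : Fin L.length, k < j ∧
      (L.get j \ L.get k).card = 1 ∧
      L.get i ∩ L.get j ⊆ L.get k ∧ L.get k ⊆ L.get i ∪ L.get j ∧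
      (L.get j).card ≤ (L.get k).card ∧ (L.get k).card ≤ (L.get i).card) :
    ∀ i j : Fin L.length, i < j →
      ∃ G : ℕ → Finset α,
        G 0 = L.get i ∧ G (dis (L.get i) (L.get j)) = L.get j ∧
        (∀ h ≤ dis (L.get i) (L.get j), IsFacet Δ (G h)) ∧
        (∀ h < dis (L.get i) (L.get j),
          (G (h + 1)).card ≤ (G h).card ∧ dis (G h) (G (h + 1)) = 1) := by
  have hanti : ∀ i j : Fin L.length, i < j → (L.get j).card ≤ (L.get i).card := by
    have : IsTrans (Finset α) (fun F G => G.card ≤ F.card) := ⟨fun _ _ _ h h' => h'.trans h⟩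
    exact List.pairwise_iff_get.mp (List.isChain_iff_pairwise.mp hdec)
  have hfacet : ∀ i : Fin L.length, IsFacet Δ (L.get i) :=
    fun i => (hL.2.1 _).mp (L.get_mem i)
  suffices hpath : ∀ n, ∀ i j : Fin L.length, i < j → dis (L.get i) (L.get j) = n →
      HasDescendingPath Δ n (L.get i) (L.get j) from fun i j hij => hpath _ i j hij rfl
  intro n
  induction n with
  | zero =>
    intro i j hij hn
    obtain ⟨k, -, hk1, hl, hu, -, -⟩ := hqh i j hij
    have hsum := card_sdiff_add_card_sdiff_of_between hl hu
    rw [dis_eq_card_sdiff_of_card_le (hanti i j hij)] at hn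
    omega
  | succ n ih =>
    intro i j hij hn
    obtain ⟨k, -, hk1, hl, hu, hjk, hki⟩ := hqh i j hij
    have hsum := card_sdiff_add_card_sdiff_of_between hl hu
    rw [dis_eq_card_sdiff_of_card_le (hanti i j hij)] at hn
    have hik : dis (L.get i) (L.get k) = n := by
      rw [dis_eq_card_sdiff_of_card_le hki]
      omega
    refine HasDescendingPath.snoc ?_ (hfacet j) hjk
      ((dis_eq_card_sdiff_of_card_le hjk).trans hk1)
    rcases lt_trichotomy i k with hlt | rfl | hgt
    · exact ih i k hlt hik
    · obtain rfl : n = 0 := by simpa [dis] using hik.symm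
      exact HasDescendingPath.refl (hfacet i)
    · exact (ih k i hgt ((dis_comm _ _).trans hik)).reverse (hki.antisymm (hanti k i hgt))
end

section
/- Let Δ be a pure simplicial complex. Then Δ is strongly shellable if and only if there exists a linear order ≻ on F(Δ) such that whenever F_i ≻ F_j, there exists a facet F_k ≻ F_j with dis(F_k, F_j) = 1 and dis(F_i, F_k) = dis(F_i, F_j) − 1. -/
variable {α : Type*}

theorem dis_eq_card_sdiff [DecidableEq α] {A B : Finset α} (h : A.card = B.card) :
    dis A B = (A \ B).card := by
  rw [dis, Finset.card_sdiff_comm h, min_self]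

/-- Both sides count `A \ (B ∩ C)`. -/
theorem card_sdiff_add_card_sdiff_inter [DecidableEq α] (A B C : Finset α) :
    (A \ C).card + ((C \ B) ∩ A).card = (A \ B).card + ((B \ C) ∩ A).card := by
  rw [← Finset.card_union_of_disjoint, ← Finset.card_union_of_disjoint]
  · congr 1
    ext x
    simp only [Finset.mem_union, Finset.mem_sdiff, Finset.mem_inter]
    tauto
  all_goals
    rw [Finset.disjoint_left]
    intro x
    simp only [Finset.mem_sdiff, Finset.mem_inter]
    tauto

/-- For sets of equal size, the exchange condition of a strong shelling order says that `C` is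
a neighbour of `B` one step closer to `A`. -/
theorem exchange_iff_dis [DecidableEq α] {A B C : Finset α} (hAB : A.card = B.card)
    (hCB : C.card = B.card) (hne : A ≠ B) :
    ((B \ C).card = 1 ∧ B \ C ⊆ B \ A ∧ C \ B ⊆ A) ↔
      dis C B = 1 ∧ dis A C = dis A B - 1 := by
  rw [dis_eq_card_sdiff hCB, dis_eq_card_sdiff hAB, dis_eq_card_sdiff (hAB.trans hCB.symm),
    ← Finset.card_sdiff_comm hCB]
  have hpos : 0 < (A \ B).card := by
    rw [Finset.card_pos, Finset.sdiff_nonempty]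
    exact fun h => hne (Finset.eq_of_subset_of_card_le h hAB.ge)
  have hcount := card_sdiff_add_card_sdiff_inter A B C
  have hcomm := Finset.card_sdiff_comm hCB
  have hle : ((C \ B) ∩ A).card ≤ (C \ B).card := Finset.card_le_card Finset.inter_subset_left
  have hsub : C \ B ⊆ A ↔ (C \ B).card ≤ ((C \ B) ∩ A).card := by
    rw [← Finset.inter_eq_left]
    exact ⟨fun h => by rw [h], Finset.eq_of_subset_of_card_le Finset.inter_subset_left⟩
  have hdisj : B \ C ⊆ B \ A ↔ ((B \ C) ∩ A).card = 0 := by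
    rw [Finset.card_eq_zero, ← Finset.disjoint_iff_inter_eq_empty, Finset.subset_sdiff]
    exact and_iff_right Finset.sdiff_subset
  rw [hsub, hdisj]
  omega

/-- a pure complex `Δ` is strongly shellable iff there is a linear
order on its facets such that whenever `F_i ≻ F_j` there is a facet `F_k ≻ F_j`
with `dis(F_k, F_j) = 1` and `dis(F_i, F_k) = dis(F_i, F_j) − 1`. -/
theorem stmt13 [DecidableEq α] (Δ : Finset (Finset α)) (hΔ : IsComplex Δ)
    (hpure : ∀ F G, IsFacet Δ F → IsFacet Δ G → F.card = G.card) :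
    StronglyShellable Δ ↔
      ∃ L : List (Finset α), L.Nodup ∧ (∀ F, F ∈ L ↔ IsFacet Δ F) ∧
        ∀ i j : Fin L.length, i < j → ∃ k : Fin L.length, k < j ∧
          dis (L.get k) (L.get j) = 1 ∧
          dis (L.get i) (L.get k) = dis (L.get i) (L.get j) - 1 := by
  refine exists_congr fun L => and_congr_right fun hnodup => and_congr_right fun hfacet =>
    forall_congr' fun i => forall_congr' fun j => imp_congr_right fun hij =>
    exists_congr fun k => and_congr_right fun _ => ?_
  have hcard (a b : Fin L.length) : (L.get a).card = (L.get b).card :=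
    hpure _ _ ((hfacet _).1 (L.get_mem a)) ((hfacet _).1 (L.get_mem b))
  exact exchange_iff_dis (hcard i j) (hcard k j)
    fun h => hij.ne (List.nodup_iff_injective_get.1 hnodup h)
end

section
/- Let G be a finite connected simple graph that has a distance-preserving order. If G contains a cycle, then the girth of G is at most 4. -/
/-- A graph `G` has a distance-preserving order: an enumeration `v₁, …, v_t` of its
vertices such that each induced subgraph on `{v_{i+1}, …, v_t}` preserves distances
with respect to the induced subgraph on `{v_i, …, v_t}`. -/
def HasDPO {V : Type*} (G : SimpleGraph V) : Prop :=
  ∃ L : List V, L.Nodup ∧ (∀ v, v ∈ L) ∧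
    ∀ (i : ℕ) (u v : V) (hu1 : u ∈ L.drop (i + 1)) (hv1 : v ∈ L.drop (i + 1))
      (hu0 : u ∈ L.drop i) (hv0 : v ∈ L.drop i),
      (G.induce {x | x ∈ L.drop (i + 1)}).dist ⟨u, hu1⟩ ⟨v, hv1⟩ =
        (G.induce {x | x ∈ L.drop i}).dist ⟨u, hu0⟩ ⟨v, hv0⟩

theorem List.exists_append_cons_of_exists {α : Type*} {p : α → Prop} {L : List α}
    (h : ∃ x ∈ L, p x) : ∃ s v t, L = s ++ v :: t ∧ p v ∧ ∀ x ∈ s, ¬ p x := by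
  induction L with
  | nil => simp at h
  | cons a l ih =>
    by_cases ha : p a
    · exact ⟨[], a, l, rfl, ha, by simp⟩
    · obtain ⟨s, v, t, rfl, hv, hs⟩ := ih (by simpa [ha] using h)
      exact ⟨a :: s, v, t, rfl, hv, by simpa [ha] using hs⟩

namespace SimpleGraph

variable {V : Type*} {G : SimpleGraph V} {a b v w : V}

theorem girth_le_three_of_adj (hva : G.Adj v a) (hab : G.Adj a b) (hbv : G.Adj b v) :
    G.girth ≤ 3 := by
  have hc : (Walk.cons hva (.cons hab (.cons hbv .nil))).IsCycle := by
    simp [Walk.isCycle_def, Walk.isTrail_def, hva.ne, hab.ne, hbv.ne, hva.ne', hbv.ne']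
  simpa using hc.girth_le_length

theorem girth_le_four_of_adj (hva : G.Adj v a) (haw : G.Adj a w) (hwb : G.Adj w b)
    (hbv : G.Adj b v) (hab : a ≠ b) (hvw : v ≠ w) : G.girth ≤ 4 := by
  have hc : (Walk.cons hva (.cons haw (.cons hwb (.cons hbv .nil)))).IsCycle := by
    simp [Walk.isCycle_def, Walk.isTrail_def, hva.ne, haw.ne, hbv.ne, hwb.ne, hva.ne', hbv.ne',
      hab, hvw, hvw.symm]
  simpa using hc.girth_le_length

/-- Two neighbours of `v` whose distance survives the deletion of `v` lie with `v` on a triangle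
or on a quadrilateral. -/
theorem girth_le_four_of_dist_induce_eq {s t : Set V} (hv : v ∈ s) (hvt : v ∉ t)
    (has : a ∈ s) (hbs : b ∈ s) (hat : a ∈ t) (hbt : b ∈ t)
    (hva : G.Adj v a) (hvb : G.Adj v b) (hab : a ≠ b)
    (hdist : (G.induce t).dist ⟨a, hat⟩ ⟨b, hbt⟩ = (G.induce s).dist ⟨a, has⟩ ⟨b, hbs⟩) :
    G.girth ≤ 4 := by
  let p : (G.induce s).Walk ⟨a, has⟩ ⟨b, hbs⟩ :=
    .cons (v := ⟨v, hv⟩) (induce_adj.mpr hva.symm) (.cons (induce_adj.mpr hvb) .nil)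
  have hle : (G.induce s).dist ⟨a, has⟩ ⟨b, hbs⟩ ≤ 2 := dist_le p
  have hpos : 0 < (G.induce s).dist ⟨a, has⟩ ⟨b, hbs⟩ :=
    p.reachable.pos_dist_of_ne (by simpa using hab)
  rw [← hdist] at hle hpos
  obtain ⟨q, hq⟩ := (Reachable.of_dist_ne_zero hpos.ne').exists_walk_length_eq_dist
  rw [← hq] at hle hpos
  match q with
  | .nil => exact absurd rfl hab
  | .cons h .nil => exact (girth_le_three_of_adj hva (induce_adj.mp h) hvb.symm).trans (by norm_num)
  | .cons (v := w) h (.cons h' .nil) =>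
    exact girth_le_four_of_adj hva (induce_adj.mp h) (induce_adj.mp h') hvb.symm hab fun hvw => hvt (hvw ▸ w.2)
  | .cons _ (.cons _ (.cons _ _)) => simp at hle

end SimpleGraph

/-- a finite connected simple graph with a distance-preserving order
that contains a cycle has girth at most `4`. -/
theorem stmt15 {V : Type*} [Fintype V] (G : SimpleGraph V)
    (hconn : G.Connected) (hdpo : HasDPO G) (hcyc : ¬ G.IsAcyclic) :
    G.girth ≤ 4 := by
  classical
  obtain ⟨L, hnodup, hmem, hL⟩ := hdpo
  simp only [SimpleGraph.IsAcyclic, not_forall, not_not] at hcyc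
  obtain ⟨u, c, hc⟩ := hcyc
  obtain ⟨s, v, t, rfl, hv, hs⟩ :=
    List.exists_append_cons_of_exists (p := (· ∈ c.support)) ⟨u, hmem u, c.start_mem_support⟩
  have hd := hc.rotate hv
  have hnil := hd.not_nil
  have hva := SimpleGraph.Walk.adj_snd hnil
  have hbv := SimpleGraph.Walk.adj_penultimate hnil
  have htail : ∀ x ∈ (c.rotate v hv).support, x ≠ v → x ∈ t := fun x hx hxv => by
    rw [SimpleGraph.Walk.mem_support_rotate_iff] at hx
    have := hmem x
    simp only [List.mem_append, List.mem_cons] at this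
    exact (this.resolve_left fun h => hs x h hx).resolve_left hxv
  have hat := htail _ ((c.rotate v hv).getVert_mem_support _) hva.ne'
  have hbt := htail _ ((c.rotate v hv).getVert_mem_support _) hbv.ne
  have hvt : v ∉ t := (List.nodup_cons.mp hnodup.of_append_right).1
  have hdrop : (s ++ v :: t).drop s.length = v :: t := by simp
  have hdrop' : (s ++ v :: t).drop (s.length + 1) = t := by simp
  refine SimpleGraph.girth_le_four_of_dist_induce_eq (s := {x | x ∈ (s ++ v :: t).drop s.length})
    (t := {x | x ∈ (s ++ v :: t).drop (s.length + 1)}) (v := v) ?_ ?_ ?_ ?_ ?_ ?_ hva hbv.symm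
    hd.snd_ne_penultimate (hL s.length _ _ ?_ ?_ ?_ ?_)
  all_goals simp only [Set.mem_ofPred_eq, hdrop, hdrop']
  all_goals first | assumption | simp [*]
end

section
/- Let Δ be a pure simplicial complex on a finite vertex set V. Then Δ is strongly shellable if and only if its complement complex Δᶜ, the pure complex whose facets are the complements V ∖ F of the facets F of Δ, is strongly shellable. -/
variable {α : Type*}

/-- The facets of the complex generated by an antichain are the members of the antichain. -/
theorem isFacet_gen [DecidableEq α] {S : Finset (Finset α)}
    (hS : IsAntichain (· ⊆ ·) (S : Set (Finset α))) {F : Finset α} :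
    IsFacet (gen S) F ↔ F ∈ S := by
  simp only [IsFacet, gen, Finset.mem_biUnion, Finset.mem_powerset]
  constructor
  · rintro ⟨⟨G, hG, hFG⟩, hmax⟩
    rwa [hmax G ⟨G, hG, subset_rfl⟩ hFG]
  · refine fun hF => ⟨⟨F, hF, subset_rfl⟩, ?_⟩
    rintro G ⟨H, hH, hGH⟩ hFG
    have hFH : F = H := hS.eq hF hH (hFG.trans hGH)
    exact hFG.antisymm (hFH ▸ hGH)

/-- Complementing every term of a strong shelling order gives a strong shelling order. -/
theorem StronglyShellable.of_isFacet_sdiff [DecidableEq α] {V : Finset α}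
    {Δ Γ : Finset (Finset α)}
    (hsub : ∀ F, IsFacet Δ F → F ⊆ V)
    (hpure : ∀ F G, IsFacet Δ F → IsFacet Δ G → F.card = G.card)
    (hΓ : ∀ G, IsFacet Γ G ↔ ∃ F, IsFacet Δ F ∧ V \ F = G)
    (h : StronglyShellable Δ) : StronglyShellable Γ := by
  obtain ⟨L, hnodup, hmem, hL⟩ := h
  have hfacet (i : Fin L.length) : IsFacet Δ (L.get i) := (hmem _).1 (L.get_mem i)
  have hlen : (L.map (V \ ·)).length = L.length := L.length_map _
  refine ⟨L.map (V \ ·), hnodup.map_on ?_, fun G => by simp [hΓ, hmem], fun i j hij => ?_⟩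
  · intro F hF G hG hFG
    rw [← Finset.sdiff_sdiff_eq_self (hsub F ((hmem F).1 hF)), hFG,
      Finset.sdiff_sdiff_eq_self (hsub G ((hmem G).1 hG))]
  · obtain ⟨k, hkj, hcard, hjk, hkj'⟩ := hL (i.cast hlen) (j.cast hlen) hij
    have hj := hsub _ (hfacet (j.cast hlen))
    have hk := hsub _ (hfacet k)
    refine ⟨k.cast hlen.symm, hkj, ?_⟩
    have hcomm := Finset.card_sdiff_comm (hpure _ _ (hfacet (j.cast hlen)) (hfacet k))
    simp only [List.get_eq_getElem, List.getElem_map, Fin.val_cast] at *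
    rw [sdiff_sdiff_sdiff_cancel_left hk, sdiff_sdiff_sdiff_cancel_left hj]
    refine ⟨hcomm ▸ hcard, ?_, ?_⟩ <;> grind

/-- a pure complex `Δ` on the vertex set `V` is strongly shellable
iff its complement complex (the complex generated by the complements `V ∖ F` of
the facets `F` of `Δ`) is strongly shellable. -/
theorem stmt16 [DecidableEq α] (V : Finset α) (Δ : Finset (Finset α))
    (hΔ : IsComplex Δ) (hsub : ∀ F ∈ Δ, F ⊆ V)
    (hpure : ∀ F G, IsFacet Δ F → IsFacet Δ G → F.card = G.card) :
    StronglyShellable Δ ↔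
      StronglyShellable
        (gen ((Δ.filter (fun F => ∀ G ∈ Δ, F ⊆ G → F = G)).image (fun F => V \ F))) := by
  have hfacets : ∀ G, IsFacet (gen ((Δ.filter (fun F => ∀ G ∈ Δ, F ⊆ G → F = G)).image
      (fun F => V \ F))) G ↔ ∃ F, IsFacet Δ F ∧ V \ F = G := by
    intro G
    rw [isFacet_gen]
    · simp [IsFacet]
    · intro A hA B hB hne hAB
      simp only [Finset.coe_image, Set.mem_image, Finset.mem_coe, Finset.mem_filter] at hA hB
      obtain ⟨F, hF, rfl⟩ := hA
      obtain ⟨H, hH, rfl⟩ := hB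
      have hHF : H ⊆ F := by
        simpa only [Finset.sdiff_sdiff_eq_self (hsub _ hF.1),
          Finset.sdiff_sdiff_eq_self (hsub _ hH.1)] using
          Finset.sdiff_subset_sdiff (subset_refl V) hAB
      exact hne (by rw [hH.2 F hF.1 hHF])
  refine ⟨.of_isFacet_sdiff (fun F hF => hsub F hF.1) hpure hfacets,
    .of_isFacet_sdiff (V := V) ?_ ?_ ?_⟩
  · intro G hG
    obtain ⟨F, -, rfl⟩ := (hfacets G).1 hG
    exact Finset.sdiff_subset
  · intro A B hA hB
    obtain ⟨F, hF, rfl⟩ := (hfacets A).1 hA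
    obtain ⟨H, hH, rfl⟩ := (hfacets B).1 hB
    rw [Finset.card_sdiff_of_subset (hsub F hF.1), Finset.card_sdiff_of_subset (hsub H hH.1),
      hpure F H hF hH]
  · intro F
    constructor
    · intro hF
      exact ⟨V \ F, (hfacets _).2 ⟨F, hF, rfl⟩, Finset.sdiff_sdiff_eq_self (hsub F hF.1)⟩
    · rintro ⟨G, hG, rfl⟩
      obtain ⟨H, hH, rfl⟩ := (hfacets G).1 hG
      rwa [Finset.sdiff_sdiff_eq_self (hsub H hH.1)]
end

section
/- Let Δ be a pure strongly shellable simplicial complex on the vertex set [n] = {1, …, n}, and let K be a field. Then the facet ideal I(Δ) = ⟨∏_{i∈F} x_i : F ∈ F(Δ)⟩ in the polynomial ring K[x₁, …, x_n] has linear quotients: there is an ordering f₁, …, f_m of the monomial generators ∏_{i∈F} x_i (F ∈ F(Δ)) such that for each 2 ≤ i ≤ m, the colon ideal ⟨f₁, …, f_{i−1}⟩ : f_i is generated by a set of variables (degree one forms). -/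
variable {α : Type*}

open MvPolynomial in
/-- A polynomial lies in the colon of a squarefree monomial ideal by `x^G` iff each of its monomials
is divisible by `x^(F \ G)` for some generator `x^F`. -/
theorem mem_span_prod_X_colon_iff {σ R : Type*} [DecidableEq σ] [CommSemiring R]
    (A : Set (Finset σ)) (G : Finset σ) (p : MvPolynomial σ R) :
    p ∈ (Ideal.span ((fun F => ∏ j ∈ F, (X j : MvPolynomial σ R)) '' A)).colon
        (Ideal.span {∏ j ∈ G, (X j : MvPolynomial σ R)}) ↔
      ∀ m ∈ p.support, ∃ F ∈ A, ∀ j ∈ F \ G, m j ≠ 0 := by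
  have hX : ∀ F : Finset σ, ∏ j ∈ F, (X j : MvPolynomial σ R) =
      monomial (Finsupp.indicator F fun _ _ => 1) 1 := fun F => by
    simpa using prod_X_pow (R := R) (fun _ => 1) F
  have himage : (fun F => ∏ j ∈ F, (X j : MvPolynomial σ R)) '' A =
      (fun s => monomial s (1 : R)) '' ((fun F => Finsupp.indicator F fun _ _ => 1) '' A) := by
    rw [Set.image_image]
    exact Set.image_congr fun F _ => hX F
  have hdvd : ∀ (F : Finset σ) (m : σ →₀ ℕ),
      (Finsupp.indicator F fun _ _ => 1) ≤ m + (Finsupp.indicator G fun _ _ => 1) ↔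
        ∀ j ∈ F \ G, m j ≠ 0 := fun F m => by
    rw [Finsupp.le_def]
    refine forall_congr' fun j => ?_
    by_cases hF : j ∈ F <;> by_cases hG : j ∈ G <;>
      simp [Finsupp.indicator_apply, hF, hG, Nat.one_le_iff_ne_zero]
  rw [Ideal.mem_colon_span_singleton, himage, mem_ideal_span_monomial_image, hX]
  simp only [Set.exists_mem_image, ← hdvd]
  constructor
  · intro h m hm
    refine h _ ?_
    rw [mem_support_iff, coeff_mul_monomial, mul_one]
    exact mem_support_iff.mp hm
  · intro h m hm
    rw [mem_support_iff, coeff_mul_monomial', mul_one] at hm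
    split_ifs at hm with hle
    · simpa only [tsub_add_cancel_of_le hle] using h _ (mem_support_iff.mpr hm)
    · exact absurd rfl hm

/-- the facet ideal of a pure strongly shellable complex on `[n]` has
linear quotients: there is an ordering `f₁, …, f_m` of the monomial generators
`x^F = ∏_{i ∈ F} x_i` (`F` a facet) such that each colon ideal
`⟨f₁, …, f_{i−1}⟩ : f_i` is generated by a set of variables. -/
theorem stmt17 (n : ℕ) (K : Type*) [Field K] (Δ : Finset (Finset (Fin n)))
    (hΔ : IsComplex Δ)
    (hpure : ∀ F G, IsFacet Δ F → IsFacet Δ G → F.card = G.card)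
    (hss : StronglyShellable Δ) :
    ∃ L : List (Finset (Fin n)), L.Nodup ∧ (∀ F, F ∈ L ↔ IsFacet Δ F) ∧
      ∀ i : Fin L.length, 0 < (i : ℕ) →
        ∃ S : Finset (Fin n),
          (Ideal.span ((fun F => ∏ j ∈ F, (MvPolynomial.X j : MvPolynomial (Fin n) K)) ''
              {F | F ∈ L.take (i : ℕ)})).colon
            (Ideal.span {∏ j ∈ L.get i, (MvPolynomial.X j : MvPolynomial (Fin n) K)}) =
          Ideal.span ((fun j => (MvPolynomial.X j : MvPolynomial (Fin n) K)) '' ↑S) := by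
  obtain ⟨L, hnodup, hmem, hshell⟩ := hss
  refine ⟨L, hnodup, hmem, fun i _ => ?_⟩
  have hfacet : ∀ k : Fin L.length, IsFacet Δ (L.get k) := fun k => (hmem _).mp (L.get_mem k)
  refine ⟨Finset.univ.filter fun v => ∃ k < i, L.get k \ L.get i = {v}, ?_⟩
  ext p
  rw [mem_span_prod_X_colon_iff, MvPolynomial.mem_ideal_span_X_image]
  refine forall₂_congr fun m _ => ⟨?_, ?_⟩
  · rintro ⟨F, hF, hm⟩
    obtain ⟨l, hl, rfl⟩ := List.mem_take_iff_getElem.mp hF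
    rw [lt_min_iff] at hl
    obtain ⟨k, hki, hcard, -, hsub⟩ := hshell ⟨l, hl.2⟩ i hl.1
    rw [Finset.card_sdiff_comm (hpure _ _ (hfacet i) (hfacet k)), Finset.card_eq_one] at hcard
    obtain ⟨v, hv⟩ := hcard
    have hvk : v ∈ L.get k \ L.get i := hv ▸ Finset.mem_singleton_self v
    exact ⟨v, by simpa using ⟨k, hki, hv⟩,
      hm v (Finset.mem_sdiff.mpr ⟨hsub hvk, (Finset.mem_sdiff.mp hvk).2⟩)⟩
  · rintro ⟨v, hv, hmv⟩
    obtain ⟨k, hki, hk⟩ := (Finset.mem_filter.mp hv).2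
    refine ⟨L.get k, List.mem_take_iff_getElem.mpr ⟨k, lt_min hki k.2, rfl⟩, fun j hj => ?_⟩
    rw [hk, Finset.mem_singleton] at hj
    rwa [hj]
end

section
/- Every matroid complex is strongly shellable. That is, if Δ is a simplicial complex satisfying the exchange property — for any two distinct facets F, G of Δ and any i ∈ F ∖ G, there exists j ∈ G ∖ F such that (F ∖ {i}) ∪ {j} ∈ Δ — then F(Δ) admits a strong shelling order. -/
variable {α : Type*}

/-- Under the exchange property, exchanging one vertex of a facet produces a facet. -/
theorem IsFacet.insert_erase [DecidableEq α] {Δ : Finset (Finset α)}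
    (hex : ∀ F G, IsFacet Δ F → IsFacet Δ G → F ≠ G →
      ∀ i ∈ F \ G, ∃ j ∈ G \ F, insert j (F.erase i) ∈ Δ)
    {F : Finset α} {i j : α} (hF : IsFacet Δ F) (hj : j ∉ F)
    (h : insert j (F.erase i) ∈ Δ) : IsFacet Δ (insert j (F.erase i)) := by
  obtain ⟨H, hle, hHΔ, hmax⟩ := Δ.exists_le_maximal h
  have hsub : insert j (F.erase i) ⊆ H := hle
  have hH : IsFacet Δ H := ⟨hHΔ, fun G hG hHG ↦ hHG.antisymm (hmax hG hHG)⟩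
  have hjH : j ∈ H := hsub (Finset.mem_insert_self _ _)
  have hne : H ≠ F := fun e ↦ hj (e ▸ hjH)
  obtain ⟨l, hl, hlΔ⟩ := hex H F hH hF hne j (Finset.mem_sdiff.2 ⟨hjH, hj⟩)
  have hFH : F = insert l (H.erase j) := by
    refine hF.2 _ hlΔ fun x hx ↦ ?_
    grind
  have hEq : insert j (F.erase i) = H := by
    refine hsub.antisymm fun x hx ↦ ?_
    grind
  rwa [hEq]

/-- Listing the facets in colexicographic order gives a strong shelling order. -/
theorem stronglyShellable_of_exchange [LinearOrder α] {Δ : Finset (Finset α)}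
    (hex : ∀ F G, IsFacet Δ F → IsFacet Δ G → F ≠ G →
      ∀ i ∈ F \ G, ∃ j ∈ G \ F, insert j (F.erase i) ∈ Δ) :
    StronglyShellable Δ := by
  classical
  let S : List (Colex (Finset α)) := ((Δ.filter (IsFacet Δ)).image toColex).sort
  have hS : S.SortedLT := Finset.sortedLT_sort _
  have hmem (F : Finset α) : F ∈ S.map ofColex ↔ IsFacet Δ F := by
    simp only [S, List.mem_map, Finset.mem_sort, Finset.mem_image, Finset.mem_filter]
    exact ⟨by rintro ⟨_, ⟨G, hG, rfl⟩, rfl⟩; exact hG.2, fun h ↦ ⟨_, ⟨F, ⟨h.1, h⟩, rfl⟩, rfl⟩⟩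
  have hmono : StrictMono fun i : Fin (S.map ofColex).length ↦
      toColex ((S.map ofColex).get i) := by
    intro i j hij
    simpa using hS.strictMono_get (a := i.cast (by simp)) (b := j.cast (by simp)) hij
  refine ⟨S.map ofColex, hS.nodup.map ofColex.injective, hmem, fun i j hij ↦ ?_⟩
  have hfacet (k) : IsFacet Δ ((S.map ofColex).get k) := (hmem _).1 (List.get_mem _ _)
  have hlt := hmono hij
  generalize S.map ofColex = L at *
  obtain ⟨x, hxj, hxi, hx⟩ := Finset.Colex.toColex_lt_toColex_iff_exists_forall_lt.1 hlt
  obtain ⟨y, hy, hyΔ⟩ := hex _ _ (hfacet j) (hfacet i) (fun e ↦ hxi (e ▸ hxj)) x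
    (Finset.mem_sdiff.2 ⟨hxj, hxi⟩)
  obtain ⟨hyi, hyj⟩ := Finset.mem_sdiff.1 hy
  obtain ⟨k, hk⟩ := List.get_of_mem ((hmem _).2 ((hfacet j).insert_erase hex hyj hyΔ))
  have hyx : y < x := hx y hyi hyj
  have hdiff : L.get j \ L.get k = {x} := by
    rw [hk]
    ext z
    grind
  refine ⟨k, hmono.lt_iff_lt.1 ?_, by rw [hdiff, Finset.card_singleton], ?_, ?_⟩
  · refine Finset.Colex.toColex_lt_toColex_iff_exists_forall_lt.2 ⟨x, hxj, ?_, fun b hb hbj ↦ ?_⟩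
    · rw [hk]
      grind
    · rw [hk] at hb
      grind
  · rw [hdiff]
    simpa using ⟨hxj, hxi⟩
  · rw [hk]
    intro z hz
    grind

/-- every matroid complex is strongly shellable. The exchange
property: for distinct facets `F`, `G` and any `i ∈ F ∖ G`, there is `j ∈ G ∖ F`
with `(F ∖ {i}) ∪ {j} ∈ Δ`. -/
theorem stmt18 [DecidableEq α] (Δ : Finset (Finset α)) (hΔ : IsComplex Δ)
    (hex : ∀ F G, IsFacet Δ F → IsFacet Δ G → F ≠ G →
      ∀ i ∈ F \ G, ∃ j ∈ G \ F, insert j (F.erase i) ∈ Δ) :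
    StronglyShellable Δ := by
  rename_i inst
  obtain ⟨lo, -⟩ := exists_wellFoundedLT α
  obtain rfl : inst = lo.toDecidableEq := Subsingleton.elim _ _
  exact stronglyShellable_of_exchange hex
end
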